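/- arXiv:0907.3435 — 2 statements merged into one kernel-verified Lean document; each statement's English description precedes it below -/
import Mathlib

section
/- The K-subalgebra of E generated by the central elements x and z is a commutative ring of Krull dimension 2. (This is the key step showing that the Hochschild cohomology ring modulo nilpotence of a tame Hecke algebra has Krull dimension 2.) -/
open FreeAlgebra

inductive Gen : Type | e1 | e2 | ep | eb | al | ab

variable (K : Type) [Field K]

/-- Relations presenting the preprojective algebra `E = KQ/⟨ε²+αᾱ, ε̄²+ᾱα⟩` of type `T̃₂`,
the Ext algebra of the tame Hecke algebra `A`. -/
inductive RelE : FreeAlgebra K Gen → FreeAlgebra K Gen → Prop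
  | sum : RelE (ι K .e1 + ι K .e2) 1
  | idem1 : RelE (ι K .e1 * ι K .e1) (ι K .e1)
  | idem2 : RelE (ι K .e2 * ι K .e2) (ι K .e2)
  | orth12 : RelE (ι K .e1 * ι K .e2) 0
  | orth21 : RelE (ι K .e2 * ι K .e1) 0
  | ep_l : RelE (ι K .e1 * ι K .ep) (ι K .ep)
  | ep_r : RelE (ι K .ep * ι K .e1) (ι K .ep)
  | eb_l : RelE (ι K .e2 * ι K .eb) (ι K .eb)
  | eb_r : RelE (ι K .eb * ι K .e2) (ι K .eb)
  | al_l : RelE (ι K .e1 * ι K .al) (ι K .al)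
  | al_r : RelE (ι K .al * ι K .e2) (ι K .al)
  | ab_l : RelE (ι K .e2 * ι K .ab) (ι K .ab)
  | ab_r : RelE (ι K .ab * ι K .e1) (ι K .ab)
  | rel1 : RelE (ι K .ep * ι K .ep + ι K .al * ι K .ab) 0
  | rel2 : RelE (ι K .eb * ι K .eb + ι K .ab * ι K .al) 0

/-- The preprojective algebra of type `T̃₂`. -/
abbrev PreprojE : Type := RingQuot (RelE K)

namespace PreprojE

noncomputable def of (g : Gen) : PreprojE K := RingQuot.mkAlgHom K (RelE K) (ι K g)

noncomputable abbrev e₁ : PreprojE K := of K .e1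
noncomputable abbrev e₂ : PreprojE K := of K .e2
noncomputable abbrev ε : PreprojE K := of K .ep
noncomputable abbrev εb : PreprojE K := of K .eb
noncomputable abbrev α : PreprojE K := of K .al
noncomputable abbrev αb : PreprojE K := of K .ab

/-- The central element `x = ε² + ε̄²`. -/
noncomputable def x : PreprojE K := ε K ^ 2 + εb K ^ 2

/-- The central element `z = εαε̄ᾱ + αε̄ᾱε + ε̄ᾱεα + ᾱεαε̄`. -/
noncomputable def z : PreprojE K :=
  ε K * α K * εb K * αb K + α K * εb K * αb K * ε K +
    εb K * αb K * ε K * α K + αb K * ε K * α K * εb K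

/-- The 16-element generating set `S`. -/
noncomputable def S : Set (PreprojE K) :=
  {e₁ K, e₂ K, ε K, α K, εb K, αb K, ε K * α K, εb K * αb K, α K * εb K, αb K * ε K,
    ε K * α K * εb K, εb K * αb K * ε K, αb K * ε K * α K, α K * εb K * αb K,
    ε K * α K * εb K * αb K, εb K * αb K * ε K * α K}

end PreprojE

/-- The images of the generators of `E` in the `2 × 2` matrices over an algebra `R` when both
vertices carry `R`, the loops act by `a` and `b`, `α` acts by `1` and `ᾱ` by `-a²`. -/
def Gen.toMatrix {R : Type} [Ring R] (a b : R) : Gen → Matrix (Fin 2) (Fin 2) R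
  | .e1 => !![1, 0; 0, 0]
  | .e2 => !![0, 0; 0, 1]
  | .ep => !![a, 0; 0, 0]
  | .eb => !![0, 0; 0, b]
  | .al => !![0, 1; 0, 0]
  | .ab => !![0, 0; -(a * a), 0]

namespace PreprojE

/-- The matrix representation of `E` attached to two elements with the same square. -/
noncomputable def rep {R : Type} [Ring R] [Algebra K R] (a b : R) (h : a * a = b * b) :
    PreprojE K →ₐ[K] Matrix (Fin 2) (Fin 2) R :=
  RingQuot.liftAlgHom K ⟨FreeAlgebra.lift K (Gen.toMatrix a b), by
    intro p q hpq
    cases hpq <;> ext i j <;> fin_cases i <;> fin_cases j <;> simp [Gen.toMatrix, ← h]⟩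

@[simp]
lemma rep_of {R : Type} [Ring R] [Algebra K R] (a b : R) (h : a * a = b * b) (g : Gen) :
    rep K a b h (of K g) = Gen.toMatrix a b g := by
  simp [rep, of]

lemma rep_x {R : Type} [Ring R] [Algebra K R] (a b : R) (h : a * a = b * b) :
    rep K a b h (x K) = !![a * a, 0; 0, a * a] := by
  simp [x, Gen.toMatrix, pow_two, ← h]

lemma rep_z {R : Type} [Ring R] [Algebra K R] (a b : R) (h : a * a = b * b) :
    rep K a b h (z K) = !![-(a * b + b * a) * (a * a), 0; 0, -(a * a) * (a * b + b * a)] := by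
  have hcomm : b * (a * (a * a)) = a * (a * (b * a)) := by
    rw [← mul_assoc a a a, ← mul_assoc a a (b * a), h]
    simp only [mul_assoc]
  simp [z, Gen.toMatrix, mul_assoc, add_mul, mul_add, add_comm, hcomm]

/-- Every point `(u, v)` with `u ≠ 0` is the value of `(x, z)` under a representation of `E` in
which both act as scalars. -/
lemma exists_rep_eq_algebraMap [IsAlgClosed K] {u : K} (hu : u ≠ 0) (v : K) :
    ∃ ρ : PreprojE K →ₐ[K] Matrix (Fin 2) (Fin 2) (Matrix (Fin 2) (Fin 2) K),
      ρ (x K) = algebraMap K _ u ∧ ρ (z K) = algebraMap K _ v := by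
  obtain ⟨p, rfl⟩ := IsAlgClosed.exists_pow_nat_eq u two_pos
  have hp : p ≠ 0 := by rintro rfl; simp at hu
  let a : Matrix (Fin 2) (Fin 2) K := !![0, 1; p ^ 2, 0]
  let b : Matrix (Fin 2) (Fin 2) K := !![p, 0; -(v / p ^ 2), -p]
  have haa : a * a = algebraMap K _ (p ^ 2) := by
    ext i j; fin_cases i <;> fin_cases j <;> simp [a, Matrix.algebraMap_matrix_apply]
  have hbb : b * b = algebraMap K _ (p ^ 2) := by
    ext i j
    fin_cases i <;> fin_cases j <;> simp [b, Matrix.algebraMap_matrix_apply]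
    all_goals ring
  have hab : -(a * b + b * a) = algebraMap K _ (v / p ^ 2) := by
    ext i j
    fin_cases i <;> fin_cases j <;> simp [a, b, Matrix.algebraMap_matrix_apply]
    all_goals field_simp; ring
  have hdiag (c : K) : !![algebraMap K (Matrix (Fin 2) (Fin 2) K) c, 0; 0, algebraMap K _ c] =
      algebraMap K (Matrix (Fin 2) (Fin 2) (Matrix (Fin 2) (Fin 2) K)) c := by
    ext i j : 2
    fin_cases i <;> fin_cases j <;> simp [Matrix.algebraMap_matrix_apply]
  refine ⟨rep K a b (haa.trans hbb.symm), ?_, ?_⟩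
  · rw [rep_x, haa, hdiag]
  · rw [rep_z, hab, neg_mul_comm, hab, haa, ← map_mul, ← map_mul,
      mul_comm (p ^ 2), div_mul_cancel₀ _ hu, hdiag]

/-- `x` and `z` satisfy no polynomial relation. -/
lemma aeval_x_z_injective [IsAlgClosed K] {T : Type} [CommRing T] [Algebra K T]
    (i : T →ₐ[K] PreprojE K) {s t : T} (hs : i s = x K) (ht : i t = z K) :
    Function.Injective (MvPolynomial.aeval (R := K) ![s, t]) := by
  rw [injective_iff_map_eq_zero]
  intro f hf
  suffices MvPolynomial.X 0 * f = 0 from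
    (mul_eq_zero.mp this).resolve_left (MvPolynomial.X_ne_zero 0)
  refine MvPolynomial.funext fun w => ?_
  rw [map_mul, MvPolynomial.eval_X, map_zero, mul_eq_zero, or_iff_not_imp_left]
  intro hw
  obtain ⟨ρ, hρx, hρz⟩ := exists_rep_eq_algebraMap K hw (w 1)
  have hcomp : (ρ.comp i).comp (MvPolynomial.aeval ![s, t]) =
      (Algebra.ofId K _).comp (MvPolynomial.aeval w) := by
    refine MvPolynomial.algHom_ext fun j => ?_
    fin_cases j <;> simp [hs, ht, hρx, hρz, Algebra.ofId_apply]
  have h := DFunLike.congr_fun hcomp f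
  rw [AlgHom.comp_apply, hf, map_zero, AlgHom.comp_apply, Algebra.ofId_apply] at h
  rw [← MvPolynomial.coe_aeval_eq_eval]
  exact (algebraMap K (Matrix (Fin 2) (Fin 2) (Matrix (Fin 2) (Fin 2) K))).injective
    (h.symm.trans (map_zero _).symm)

end PreprojE

/-- An algebra generated by two algebraically independent elements has Krull dimension `2`. -/
lemma ringKrullDim_eq_two_of_adjoin_pair {T : Type} [CommRing T] [Algebra K T] {s t : T}
    (hinj : Function.Injective (MvPolynomial.aeval (R := K) ![s, t]))
    (htop : Algebra.adjoin K {s, t} = ⊤) : ringKrullDim T = 2 := by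
  have hsurj : Function.Surjective (MvPolynomial.aeval (R := K) ![s, t]) := by
    rw [← AlgHom.range_eq_top, ← Algebra.adjoin_range_eq_range_aeval, ← htop]
    simp [Set.pair_comm]
  rw [← ringKrullDim_eq_of_ringEquiv (AlgEquiv.ofBijective _ ⟨hinj, hsurj⟩).toRingEquiv,
    MvPolynomial.ringKrullDim_of_isNoetherianRing]
  simp

open PreprojE in
/-- The subalgebra of `E` generated by the central elements `x` and `z` is a commutative
ring of Krull dimension 2. -/
theorem krull_dim_adjoin_x_z (K : Type) [Field K] [IsAlgClosed K]
    (hx : x K ∈ Subalgebra.center K (PreprojE K))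
    (hz : z K ∈ Subalgebra.center K (PreprojE K)) :
    letI : CommRing (Algebra.adjoin K ({x K, z K} : Set (PreprojE K))) :=
      Algebra.adjoinCommRingOfComm K (by
        rintro a ha b hb
        rcases ha with rfl | ha
        · exact ((Subalgebra.mem_center_iff.mp hx) b).symm
        · rcases ha with rfl
          exact ((Subalgebra.mem_center_iff.mp hz) b).symm)
    ringKrullDim (Algebra.adjoin K ({x K, z K} : Set (PreprojE K))) = 2 := by
  set T := Algebra.adjoin K ({x K, z K} : Set (PreprojE K))
  let _ : CommRing T := Algebra.adjoinCommRingOfComm K fun a ha b _ =>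
    (Subalgebra.mem_center_iff.mp (Set.pair_subset hx hz ha) b).symm
  have hxT : x K ∈ T := Algebra.subset_adjoin (by simp)
  have hzT : z K ∈ T := Algebra.subset_adjoin (by simp)
  refine ringKrullDim_eq_two_of_adjoin_pair K (s := ⟨x K, hxT⟩) (t := ⟨z K, hzT⟩)
    (aeval_x_z_injective K T.val rfl rfl) ?_
  rw [← Algebra.adjoin_adjoin_coe_preimage (R := K) (s := ({x K, z K} : Set (PreprojE K)))]
  congr 1
  ext y
  simp [Subtype.ext_iff]
end

section
/- For every n ≥ 0, write n = 4k+i with k ≥ 0 and 0 ≤ i ≤ 3. Then dim_K Ext^n_{Λ^e}(Λ, T_{11}) = dim_K Ext^n_{Λ^e}(Λ, T_{22}) equals 2k+1 if i ∈ {0,1} and equals 2k+i−1 if i ∈ {2,3}; and dim_K Ext^n_{Λ^e}(Λ, T_{12}) = dim_K Ext^n_{Λ^e}(Λ, T_{21}) equals 2k+i if i ∈ {0,1} and equals 2k+2 if i ∈ {2,3}. (These dimensions are the multiplicities of the indecomposable projective bimodules Λe_i ⊗_K e_jΛ in the n-th term of the minimal projective Λ-Λ-bimodule resolution of Λ.)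 -/
open FreeAlgebra

variable (K : Type) [Field K] (r s : ℕ)

/-- Relations presenting the special biserial algebra `Λ = KQ/I′`, where `I′` is generated by
`αε̄, εα, ᾱε, ε̄ᾱ, ε^r − (αᾱ)^s, ε̄^r − (ᾱα)^s`. -/
inductive RelL : FreeAlgebra K Gen → FreeAlgebra K Gen → Prop
  | sum : RelL (ι K .e1 + ι K .e2) 1
  | idem1 : RelL (ι K .e1 * ι K .e1) (ι K .e1)
  | idem2 : RelL (ι K .e2 * ι K .e2) (ι K .e2)
  | orth12 : RelL (ι K .e1 * ι K .e2) 0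
  | orth21 : RelL (ι K .e2 * ι K .e1) 0
  | ep_l : RelL (ι K .e1 * ι K .ep) (ι K .ep)
  | ep_r : RelL (ι K .ep * ι K .e1) (ι K .ep)
  | eb_l : RelL (ι K .e2 * ι K .eb) (ι K .eb)
  | eb_r : RelL (ι K .eb * ι K .e2) (ι K .eb)
  | al_l : RelL (ι K .e1 * ι K .al) (ι K .al)
  | al_r : RelL (ι K .al * ι K .e2) (ι K .al)
  | ab_l : RelL (ι K .e2 * ι K .ab) (ι K .ab)
  | ab_r : RelL (ι K .ab * ι K .e1) (ι K .ab)
  | zero1 : RelL (ι K .al * ι K .eb) 0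
  | zero2 : RelL (ι K .ep * ι K .al) 0
  | zero3 : RelL (ι K .ab * ι K .ep) 0
  | zero4 : RelL (ι K .eb * ι K .ab) 0
  | pow1 : RelL ((ι K .ep) ^ r) ((ι K .al * ι K .ab) ^ s)
  | pow2 : RelL ((ι K .eb) ^ r) ((ι K .ab * ι K .al) ^ s)

/-- The special biserial algebra `Λ = KQ/I′`. -/
abbrev LambdaAlg : Type := RingQuot (RelL K r s)

open scoped TensorProduct

attribute [local instance] TensorProduct.Algebra.module

/-- The enveloping algebra `Λ^e = Λ^op ⊗_K Λ`. -/
abbrev LambdaAe : Type := (LambdaAlg K r s)ᵐᵒᵖ ⊗[K] LambdaAlg K r s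

/-- `Λ` as a `Λ^e`-module (i.e. as a `Λ`-`Λ`-bimodule). -/
noncomputable def LambdaBimod : ModuleCat (LambdaAe K r s) := ModuleCat.of _ (LambdaAlg K r s)

/-- The character of `Λ` at the vertex 1: `e₁ ↦ 1`, `e₂ ↦ 0`, all arrows `↦ 0`. -/
noncomputable def chi1 (hr : 2 ≤ r) (hs : 1 ≤ s) : LambdaAlg K r s →ₐ[K] K :=
  RingQuot.liftAlgHom K ⟨FreeAlgebra.lift K fun g => match g with
      | Gen.e1 => (1 : K)
      | _ => 0,
    by
      have hr0 : r ≠ 0 := by omega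
      have hs0 : s ≠ 0 := by omega
      intro x y h; cases h <;> simp [zero_pow hr0, zero_pow hs0]⟩

/-- The character of `Λ` at the vertex 2: `e₂ ↦ 1`, `e₁ ↦ 0`, all arrows `↦ 0`. -/
noncomputable def chi2 (hr : 2 ≤ r) (hs : 1 ≤ s) : LambdaAlg K r s →ₐ[K] K :=
  RingQuot.liftAlgHom K ⟨FreeAlgebra.lift K fun g => match g with
      | Gen.e2 => (1 : K)
      | _ => 0,
    by
      have hr0 : r ≠ 0 := by omega
      have hs0 : s ≠ 0 := by omega
      intro x y h; cases h <;> simp [zero_pow hr0, zero_pow hs0]⟩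

/-- The algebra map `Λ^e → K` giving the bimodule on which `Λ` acts on the left through `f`
and on the right through `g`. -/
noncomputable def phiBim (f g : LambdaAlg K r s →ₐ[K] K) : LambdaAe K r s →ₐ[K] K :=
  Algebra.TensorProduct.lift (f.fromOpposite fun _ _ => Commute.all _ _) g
    fun _ _ => Commute.all _ _

/-- The one-dimensional `Λ`-`Λ`-bimodule (simple `Λ^e`-module) `T_{ij}`, on which `e_i` acts
as `1` on the left, `e_j` acts as `1` on the right, and all arrows act as `0`. -/
noncomputable def SimpleBimod (f g : LambdaAlg K r s →ₐ[K] K) : ModuleCat (LambdaAe K r s) :=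
  @ModuleCat.of (LambdaAe K r s) _ K _ (Module.compHom K (phiBim K r s f g).toRingHom)

namespace EnvExt

section Dual

open MulOpposite CategoryTheory

variable {K : Type} [Field K] {A : Type} [Ring A] [Algebra K A]

/-- The action of the enveloping algebra on the dual of a left `A`-module `M`: the opposite factor
acts by precomposition, the other factor acts through the character `χ`. -/
noncomputable def dualAct (χ : A →ₐ[K] K) (M : Type) [AddCommGroup M] [Module K M] [Module A M]
    [IsScalarTower K A M] : Aᵐᵒᵖ ⊗[K] A →ₐ[K] Module.End K (Module.Dual K M) :=
  Algebra.TensorProduct.lift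
    (AlgHom.ofLinearMap
      { toFun := fun a => (Algebra.lsmul K K M a.unop).dualMap
        map_add' := fun a b => by ext; simp
        map_smul' := fun c a => by ext; simp }
      (by ext; simp)
      (fun a b => by ext; simp))
    ((Algebra.ofId K (Module.End K (Module.Dual K M))).comp χ)
    (fun a b => by
      rw [AlgHom.comp_apply]
      exact (Algebra.commutes _ _).symm)

/-- The bimodule `Hom_K(M, K_χ)`. -/
noncomputable def dualBimod (χ : A →ₐ[K] K) (M : Type) [AddCommGroup M] [Module K M] [Module A M]
    [IsScalarTower K A M] : ModuleCat (Aᵐᵒᵖ ⊗[K] A) :=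
  @ModuleCat.of _ _ (Module.Dual K M) _ (Module.compHom _ (dualAct χ M).toRingHom)

variable (χ : A →ₐ[K] K) (M : Type) [AddCommGroup M] [Module K M] [Module A M]
    [IsScalarTower K A M]

/-- The underlying functional of an element of `dualBimod`. -/
noncomputable def toDual : dualBimod χ M ≃+ Module.Dual K M := AddEquiv.refl _

lemma toDual_smul (z : Aᵐᵒᵖ ⊗[K] A) (φ : dualBimod χ M) :
    toDual χ M (z • φ) = dualAct χ M z (toDual χ M φ) := rfl

lemma toDual_tmul_smul (a b : A) (φ : dualBimod χ M) (m : M) :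
    toDual χ M ((op a ⊗ₜ[K] b) • φ) m = χ b * toDual χ M φ (a • m) := by
  rw [toDual_smul, dualAct, Algebra.TensorProduct.lift_tmul]
  simp [Algebra.ofId_apply, Module.algebraMap_end_apply]

/-- Linear maps out of a module over the enveloping algebra can be checked on pure tensors. -/
noncomputable def homMk {X Y : ModuleCat (Aᵐᵒᵖ ⊗[K] A)} (f : X →+ Y)
    (h : ∀ (a b : A) (p : X), f ((op a ⊗ₜ[K] b) • p) = (op a ⊗ₜ[K] b) • f p) : X ⟶ Y :=
  ModuleCat.ofHom
    { f with
      map_smul' := fun z p => by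
        induction z with
        | zero =>
          exact (congrArg f (zero_smul (Aᵐᵒᵖ ⊗[K] A) p)).trans
            (f.map_zero.trans (zero_smul (Aᵐᵒᵖ ⊗[K] A) (f p)).symm)
        | tmul a b => exact h a.unop b p
        | add z w hz hw =>
          refine (congrArg f (add_smul z w p)).trans ((f.map_add _ _).trans ?_)
          exact (congrArg₂ (· + ·) hz hw).trans (add_smul z w (f p)).symm }

@[simp] lemma homMk_apply {X Y : ModuleCat (Aᵐᵒᵖ ⊗[K] A)} (f : X →+ Y) (h) (p : X) :
    homMk f h p = f p := rfl

variable {M} {N : Type} [AddCommGroup N] [Module K N] [Module A N]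
    [IsScalarTower K A N]

/-- Functoriality of `dualBimod`. -/
noncomputable def dualMap (f : N →ₗ[A] M) : dualBimod χ M ⟶ dualBimod χ N :=
  homMk ((toDual χ N).symm.toAddMonoidHom.comp
    (((f.restrictScalars K).dualMap.toAddMonoidHom).comp (toDual χ M).toAddMonoidHom))
    (fun a b p => by
      apply (toDual χ N).injective
      ext n
      rw [toDual_tmul_smul]
      simp [toDual_tmul_smul])

variable (M) in
/-- The functionals on `M` on which `A` acts through `χ`. -/
def chiHom : Submodule K (Module.Dual K M) where
  carrier := {φ | ∀ (a : A) (m : M), φ (a • m) = χ a * φ m}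
  add_mem' := fun h h' a m => by simp [h a m, h' a m, mul_add]
  zero_mem' := fun a m => by simp
  smul_mem' := fun c φ h a m => by simp [h a m]; ring

end Dual

section Left
open MulOpposite CategoryTheory
variable {K : Type} [Field K] {A : Type} [Ring A] [Algebra K A]

variable (K A) in
/-- The regular bimodule. -/
noncomputable def bimod : ModuleCat (Aᵐᵒᵖ ⊗[K] A) := ModuleCat.of _ A

variable (K A) in
/-- Restriction of a bimodule to the left `A`-action. -/
noncomputable abbrev leftRes : ModuleCat.{0} (Aᵐᵒᵖ ⊗[K] A) ⥤ ModuleCat.{0} A :=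
  ModuleCat.restrictScalars
    (Algebra.TensorProduct.includeRight : A →ₐ[K] Aᵐᵒᵖ ⊗[K] A).toRingHom

instance : (leftRes K A).PreservesHomology :=
  Functor.preservesHomology_of_map_exact _ fun S hS => by
    rw [ShortComplex.moduleCat_exact_iff] at hS ⊢
    exact hS

lemma projective_leftRes_env :
    Module.Projective A ((leftRes K A).obj (ModuleCat.of _ (Aᵐᵒᵖ ⊗[K] A))) := by
  let e : A ⊗[K] Aᵐᵒᵖ ≃ₗ[A] ((leftRes K A).obj (ModuleCat.of _ (Aᵐᵒᵖ ⊗[K] A))) :=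
    { (TensorProduct.comm K A Aᵐᵒᵖ).toAddEquiv with
      map_smul' := fun a z => by
        change TensorProduct.comm K A Aᵐᵒᵖ (a • z) =
          (1 ⊗ₜ[K] a : Aᵐᵒᵖ ⊗[K] A) * TensorProduct.comm K A Aᵐᵒᵖ z
        induction z with
        | zero => simp
        | tmul b c => simp [TensorProduct.smul_tmul']
        | add z w hz hw => simp only [smul_add, map_add, hz, hw, mul_add] }
  exact Module.Projective.of_equiv e

instance : (leftRes K A).PreservesProjectiveObjects where
  projective_obj {X} hX := by
    let f := (Algebra.TensorProduct.includeRight : A →ₐ[K] Aᵐᵒᵖ ⊗[K] A).toRingHom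
    have : (ModuleCat.coextendScalars.{0} f).PreservesEpimorphisms := ⟨fun {M N} g hg => by
      rw [ModuleCat.epi_iff_surjective] at hg ⊢
      intro φ
      have := projective_leftRes_env (K := K) (A := A)
      obtain ⟨ψ, hψ⟩ := Module.projective_lifting_property g.hom
        (φ : ((leftRes K A).obj (ModuleCat.of _ (Aᵐᵒᵖ ⊗[K] A))) →ₗ[A] N) hg
      exact ⟨ψ, hψ⟩⟩
    exact (ModuleCat.restrictCoextendScalarsAdj.{0} f).map_projective X hX

lemma projective_leftRes_bimod : Projective ((leftRes K A).obj (bimod K A)) := by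
  let e : A ≃ₗ[A] ((leftRes K A).obj (bimod K A)) :=
    { AddEquiv.refl A with
      map_smul' := fun a z => by
        change a * z = (1 ⊗ₜ[K] a : Aᵐᵒᵖ ⊗[K] A) • z
        rw [TensorProduct.Algebra.smul_def]
        simp }
  have := Module.Projective.of_equiv e
  exact ModuleCat.projective_of_categoryTheory_projective _

/-- The module over `A` given by a character. -/
noncomputable def charMod (χ : A →ₐ[K] K) : ModuleCat A :=
  @ModuleCat.of A _ K _ (Module.compHom K χ.toRingHom)

lemma exists_extension (χ : A →ₐ[K] K) (P : ProjectiveResolution (bimod K A)) (n : ℕ)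
    (φ : P.complex.X (n + 1) →+ K)
    (hφ : ∀ (b : A) p, φ (((1 : Aᵐᵒᵖ) ⊗ₜ[K] b) • p) = χ b * φ p)
    (h : ∀ p, φ (P.complex.d (n + 2) (n + 1) p) = 0) :
    ∃ ψ : P.complex.X n →+ K, (∀ (b : A) p, ψ (((1 : Aᵐᵒᵖ) ⊗ₜ[K] b) • p) = χ b * ψ p) ∧
      ∀ p, φ p = ψ (P.complex.d (n + 1) n p) := by
  let Q := (leftRes K A).mapProjectiveResolution P
  have := projective_leftRes_bimod (K := K) (A := A)
  have h0 := (isZero_Ext_succ_of_projective (R := K) ((leftRes K A).obj (bimod K A))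
    (charMod χ) n).of_iso (Q.isoExt (n + 1) (charMod χ)).symm
  rw [← HomologicalComplex.exactAt_iff_isZero_homology,
    HomologicalComplex.exactAt_iff' _ n (n + 1) (n + 2) (by simp) (by simp),
    ShortComplex.moduleCat_exact_iff] at h0
  let : Module A K := Module.compHom K χ.toRingHom
  let f : Q.complex.X (n + 1) ⟶ charMod χ := ModuleCat.ofHom
    (X := (leftRes K A).obj (P.complex.X (n + 1)))
    { toFun := φ, map_add' := φ.map_add, map_smul' := hφ }
  obtain ⟨g, hg⟩ := h0 f (by
    refine ModuleCat.hom_ext (LinearMap.ext fun p => ?_)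
    exact h p)
  refine ⟨AddMonoidHom.mk' g.hom (fun a b => g.hom.map_add a b), fun b p => g.hom.map_smul b p, ?_⟩
  intro p
  exact (congrArg (fun f => f.hom p) hg).symm

end Left

section Acyclic
open MulOpposite CategoryTheory
variable {K : Type} [Field K] {A : Type} [Ring A] [Algebra K A]
variable (χ : A →ₐ[K] K) (M : Type) [AddCommGroup M] [Module K M] [Module A M]
    [IsScalarTower K A M]

/-- A finite dual basis: `M` is a direct summand of a finite free module. -/
def HasDualBasis (A M : Type) [Ring A] [AddCommGroup M] [Module A M] : Prop :=
  ∃ (N : ℕ) (m : Fin N → M) (f : Fin N → M →ₗ[A] A), ∀ v, ∑ j, f j v • m j = v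

variable {M}

lemma tmul_smul_smul {X : ModuleCat (Aᵐᵒᵖ ⊗[K] A)} (a b : Aᵐᵒᵖ) (c d : A) (p : X) :
    (a ⊗ₜ[K] c) • (b ⊗ₜ[K] d) • p = ((a * b) ⊗ₜ[K] (c * d)) • p := by
  rw [smul_smul, Algebra.TensorProduct.tmul_mul_tmul]

lemma exists_lift (hM : HasDualBasis A M) (P : ProjectiveResolution (bimod K A)) (n : ℕ)
    (c : P.complex.X (n + 1) ⟶ dualBimod χ M) (hc : P.complex.d (n + 2) (n + 1) ≫ c = 0) :
    ∃ c' : P.complex.X n ⟶ dualBimod χ M, P.complex.d (n + 1) n ≫ c' = c := by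
  obtain ⟨N, m, f, hmf⟩ := hM
  have hsm : ∀ (a b : A) (p : P.complex.X (n + 1)) (v : M),
      toDual χ M (c ((op a ⊗ₜ[K] b) • p)) v = χ b * toDual χ M (c p) (a • v) := fun a b p v => by
    rw [map_smul, toDual_tmul_smul]
  let φ : Fin N → P.complex.X (n + 1) →+ K := fun j =>
    AddMonoidHom.mk' (fun p => toDual χ M (c p) (m j)) (fun p q => by simp)
  have h1 : ∀ j, ∃ ψ : P.complex.X n →+ K,
      (∀ (b : A) p, ψ (((1 : Aᵐᵒᵖ) ⊗ₜ[K] b) • p) = χ b * ψ p) ∧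
      ∀ p, φ j p = ψ (P.complex.d (n + 1) n p) := fun j => by
    refine exists_extension χ P n (φ j) (fun b p => ?_) (fun p => ?_)
    · have := hsm 1 b p (m j)
      rw [one_smul] at this
      exact this
    · have := congrArg (fun g => toDual χ M (g.hom p) (m j)) hc
      exact this
  choose ψ hψ hφ using h1
  have hscal : ∀ j (k : K) (a : A) (p : P.complex.X n),
      ψ j ((op (k • a) ⊗ₜ[K] (1 : A)) • p) = k * ψ j ((op a ⊗ₜ[K] (1 : A)) • p) := by
    intro j k a p
    have : (op (k • a) ⊗ₜ[K] (1 : A)) • p =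
        ((1 : Aᵐᵒᵖ) ⊗ₜ[K] (algebraMap K A k)) • (op a ⊗ₜ[K] (1 : A)) • p := by
      rw [tmul_smul_smul, one_mul, mul_one, op_smul, Algebra.algebraMap_eq_smul_one,
        ← TensorProduct.smul_tmul]
    rw [this, hψ]
    simp
  let D : P.complex.X n → Module.Dual K M := fun p =>
    { toFun := fun v => ∑ j, ψ j ((op (f j v) ⊗ₜ[K] (1 : A)) • p)
      map_add' := fun v w => by
        simp [TensorProduct.add_tmul, add_smul, Finset.sum_add_distrib]
      map_smul' := fun k v => by
        have : ∀ j, f j (k • v) = k • f j v := fun j => ((f j).restrictScalars K).map_smul k v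
        simp [this, hscal, Finset.mul_sum, -op_smul] }
  have hD : ∀ p v, D p v = ∑ j, ψ j ((op (f j v) ⊗ₜ[K] (1 : A)) • p) := fun _ _ => rfl
  let c' : P.complex.X n ⟶ dualBimod χ M := homMk
    ((toDual χ M).symm.toAddMonoidHom.comp (AddMonoidHom.mk' D (fun p q => by
      ext v; simp [hD, Finset.sum_add_distrib])))
    (fun a b p => by
      apply (toDual χ M).injective
      ext v
      rw [toDual_tmul_smul]
      change D _ v = χ b * D p (a • v)
      rw [hD, hD, Finset.mul_sum]
      refine Finset.sum_congr rfl fun j _ => ?_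
      rw [← hψ, tmul_smul_smul, tmul_smul_smul]
      simp)
  refine ⟨c', ?_⟩
  refine ModuleCat.hom_ext (LinearMap.ext fun p => ?_)
  apply (toDual χ M).injective
  ext v
  change D (P.complex.d (n + 1) n p) v = toDual χ M (c p) v
  rw [hD]
  conv_rhs => rw [← hmf v, map_sum]
  refine Finset.sum_congr rfl fun j _ => ?_
  rw [← map_smul, ← hφ]
  have := hsm (f j v) 1 p (m j)
  rw [map_one, one_mul] at this
  exact this

lemma isZero_homology_succ (hM : HasDualBasis A M) (P : ProjectiveResolution (bimod K A)) (n : ℕ) :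
    Limits.IsZero ((P.complex.linearYonedaObj K (dualBimod χ M)).homology (n + 1)) := by
  rw [← HomologicalComplex.exactAt_iff_isZero_homology,
    HomologicalComplex.exactAt_iff' _ n (n + 1) (n + 2) (by simp) (by simp),
    ShortComplex.moduleCat_exact_iff]
  intro c hc
  exact exists_lift χ hM P n c hc

end Acyclic

section LES
open CategoryTheory

variable {K : Type} [Field K] {C : Type 1} [Category.{0} C] [Abelian C] [Linear K C]
  {X : C} (P : ProjectiveResolution X)

/-- The functoriality of the Hom complex in the target. -/
noncomputable def yonedaObjMap {Y Z : C} (g : Y ⟶ Z) :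
    P.complex.linearYonedaObj K Y ⟶ P.complex.linearYonedaObj K Z where
  f i := ModuleCat.ofHom (X := P.complex.X i ⟶ Y) (Y := P.complex.X i ⟶ Z)
    (Linear.rightComp K (P.complex.X i) g)
  comm' i j _ := by
    refine ModuleCat.hom_ext (LinearMap.ext fun c => ?_)
    exact (Category.assoc _ _ _).symm

/-- The short complex of Hom complexes attached to a short complex. -/
noncomputable def yonedaShortComplex (S : ShortComplex C) :
    ShortComplex (CochainComplex (ModuleCat K) ℕ) :=
  ShortComplex.mk (yonedaObjMap P S.f) (yonedaObjMap P S.g) (by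
    refine HomologicalComplex.hom_ext _ _ fun i => ModuleCat.hom_ext (LinearMap.ext fun c => ?_)
    have key : ∀ c : P.complex.X i ⟶ S.X₁, (c ≫ S.f) ≫ S.g = 0 := fun c => by simp
    exact key c)

lemma yonedaShortComplex_shortExact {S : ShortComplex C} (hS : S.ShortExact) :
    (yonedaShortComplex (K := K) P S).ShortExact := by
  have := hS.mono_f
  have := hS.epi_g
  refine HomologicalComplex.shortExact_of_degreewise_shortExact _ fun i => ?_
  have hP := P.projective i
  refine { exact := ?_, mono_f := ?_, epi_g := ?_ }
  · rw [ShortComplex.moduleCat_exact_iff]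
    intro c hc
    exact ⟨hS.exact.lift c hc, hS.exact.lift_f c hc⟩
  · rw [ModuleCat.mono_iff_injective]
    intro c c' h
    exact (cancel_mono S.f).1 h
  · rw [ModuleCat.epi_iff_surjective]
    intro c
    exact ⟨Projective.factorThru c S.g, Projective.factorThru_comp c S.g⟩

/-- The augmentation of a projective resolution. -/
noncomputable def augmentation : P.complex.X 0 ⟶ X := P.π.f 0

lemma d_comp_augmentation : P.complex.d 1 0 ≫ augmentation P = 0 := P.complex_d_comp_π_f_zero

instance : Epi (augmentation P) := inferInstanceAs (Epi (P.π.f 0))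

lemma exists_comp_π {Y : C} (c : P.complex.X 0 ⟶ Y) (hc : P.complex.d 1 0 ≫ c = 0) :
    ∃ c' : X ⟶ Y, augmentation P ≫ c' = c :=
  let h := Limits.CokernelCofork.IsColimit.desc' P.isColimitCokernelCofork c hc
  ⟨h.1, h.2⟩

lemma iCycles_injective (F : CochainComplex (ModuleCat K) ℕ) (n : ℕ) :
    Function.Injective (F.iCycles n) := (ModuleCat.mono_iff_injective _).1 inferInstance

lemma finrank_homology_zero (Y : C) :
    Module.finrank K ((P.complex.linearYonedaObj K Y).homology 0) = Module.finrank K (X ⟶ Y) := by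
  let F := P.complex.linearYonedaObj K Y
  let l : ModuleCat.of K (X ⟶ Y) ⟶ F.X 0 :=
    ModuleCat.ofHom (X := X ⟶ Y) (Y := P.complex.X 0 ⟶ Y)
      (Linear.leftComp K Y (augmentation P))
  have hl : l ≫ F.d 0 1 = 0 := by
    refine ModuleCat.hom_ext (LinearMap.ext fun c => ?_)
    have key : ∀ c : X ⟶ Y, P.complex.d 1 0 ≫ augmentation P ≫ c = 0 := fun c => by
      rw [← Category.assoc, d_comp_augmentation, Limits.zero_comp]
    exact key c
  let L := F.liftCycles l 1 (by simp) hl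
  have hL : ∀ c, F.iCycles 0 (L c) = augmentation P ≫ c := fun c =>
    congrArg (fun g => g.hom c) (F.liftCycles_i l 1 (by simp) hl)
  have hbij : Function.Bijective L := by
    constructor
    · intro c c' h
      have h2 := congrArg (F.iCycles 0) h
      rw [hL, hL] at h2
      exact (cancel_epi (augmentation P)).1 h2
    · intro z
      have hz : P.complex.d 1 0 ≫ (F.iCycles 0 z : P.complex.X 0 ⟶ Y) = 0 :=
        congrArg (fun g => g.hom z) (F.iCycles_d 0 1)
      obtain ⟨c, hc⟩ := exists_comp_π P _ hz
      refine ⟨c, iCycles_injective F 0 ?_⟩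
      rw [hL, hc]
  rw [← (F.isoHomologyπ₀.toLinearEquiv).finrank_eq]
  exact (LinearEquiv.ofBijective L.hom hbij).finrank_eq.symm

lemma homologyMap_zero_eq_zero {Y Z : C} (g : Y ⟶ Z) (h : ∀ c : X ⟶ Y, c ≫ g = 0) :
    HomologicalComplex.homologyMap (yonedaObjMap (K := K) P g) 0 = 0 := by
  have h1 : HomologicalComplex.cyclesMap (yonedaObjMap (K := K) P g) 0 = 0 := by
    refine ModuleCat.hom_ext (LinearMap.ext fun z => iCycles_injective _ 0 ?_)
    have h2 := congrArg (fun g => g.hom z)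
      (HomologicalComplex.cyclesMap_i (yonedaObjMap (K := K) P g) 0)
    refine h2.trans ?_
    have hz : P.complex.d 1 0 ≫
        ((P.complex.linearYonedaObj K Y).iCycles 0 z : P.complex.X 0 ⟶ Y) = 0 :=
      congrArg (fun g => g.hom z) ((P.complex.linearYonedaObj K Y).iCycles_d 0 1)
    obtain ⟨c, hc⟩ := exists_comp_π P _ hz
    have key : (augmentation P ≫ c) ≫ g = 0 := by rw [Category.assoc, h, Limits.comp_zero]
    rw [hc] at key
    exact key.trans (map_zero ((P.complex.linearYonedaObj K Z).iCycles 0).hom).symm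
  rw [← cancel_epi (HomologicalComplex.homologyπ _ 0), HomologicalComplex.homologyπ_naturality, h1]
  simp

/-- Dimension shifting. -/
lemma finrank_homology_shift {S : ShortComplex C} (hS : S.ShortExact)
    (h2 : ∀ n, Limits.IsZero ((P.complex.linearYonedaObj K S.X₂).homology (n + 1)))
    (h0 : ∀ c : X ⟶ S.X₂, c ≫ S.g = 0) (n : ℕ) :
    Module.finrank K ((P.complex.linearYonedaObj K S.X₁).homology (n + 1)) =
      Module.finrank K ((P.complex.linearYonedaObj K S.X₃).homology n) := by
  have hE := yonedaShortComplex_shortExact (K := K) P hS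
  have : IsIso (hE.δ n (n + 1) rfl) := by
    have : Epi (hE.δ n (n + 1) rfl) := hE.epi_δ n (n + 1) rfl (h2 n)
    have : Mono (hE.δ n (n + 1) rfl) := by
      cases n with
      | zero =>
        exact (hE.homology_exact₃ 0 1 rfl).mono_g (homologyMap_zero_eq_zero P S.g h0)
      | succ n => exact hE.mono_δ (n + 1) (n + 2) rfl (h2 n)
    exact isIso_of_mono_of_epi _
  exact ((asIso (hE.δ n (n + 1) rfl)).toLinearEquiv.finrank_eq).symm

end LES

section Resolution
open MulOpposite CategoryTheory
variable {K : Type} [Field K] {A : Type} [Ring A] [Algebra K A] (χ : A →ₐ[K] K)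

section
variable {M : Type} [AddCommGroup M] [Module K M] [Module A M] [IsScalarTower K A M]

lemma toDual_map_one_mem (c : bimod K A ⟶ dualBimod χ M) :
    toDual χ M (c (1 : A)) ∈ chiHom χ M := fun a m => by
  have h1 : (op a ⊗ₜ[K] (1 : A)) • (1 : A) = ((1 : Aᵐᵒᵖ) ⊗ₜ[K] a) • (1 : A) := by
    simp [TensorProduct.Algebra.smul_def]
  have h2 : (op a ⊗ₜ[K] (1 : A)) • c (1 : A) = ((1 : Aᵐᵒᵖ) ⊗ₜ[K] a) • c (1 : A) :=
    (c.hom.map_smul _ _).symm.trans ((congrArg c.hom h1).trans (c.hom.map_smul _ _))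
  have h3 := congrArg (fun φ => toDual χ M φ m) h2
  have h4 := toDual_tmul_smul χ M a 1 (c (1 : A)) m
  have h5 := toDual_tmul_smul χ M 1 a (c (1 : A)) m
  rw [map_one, one_mul] at h4
  rw [one_smul] at h5
  exact h4.symm.trans (h3.trans h5)

lemma map_eq_smul_map_one (c : bimod K A ⟶ dualBimod χ M) (a : A) :
    c a = ((1 : Aᵐᵒᵖ) ⊗ₜ[K] a) • c (1 : A) := by
  have h1 : ((1 : Aᵐᵒᵖ) ⊗ₜ[K] a) • (1 : A) = a := by
    simp [TensorProduct.Algebra.smul_def]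
  exact (congrArg c.hom h1).symm.trans (c.hom.map_smul _ _)

variable (M) in
/-- Bimodule maps from the regular bimodule to `dualBimod χ M` are the `χ`-semi-invariant
functionals on `M`. -/
noncomputable def homBimodEquiv : (bimod K A ⟶ dualBimod χ M) ≃ₗ[K] chiHom χ M :=
  LinearEquiv.ofBijective
    { toFun := fun c => ⟨toDual χ M (c (1 : A)), toDual_map_one_mem χ c⟩
      map_add' := fun c c' => rfl
      map_smul' := fun k c => by
        refine Subtype.ext (LinearMap.ext fun m => ?_)
        have h := toDual_tmul_smul χ M (1 : A) (algebraMap K A k) (c (1 : A)) m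
        rw [one_smul, AlgHom.commutes] at h
        have h1 : algebraMap K (Aᵐᵒᵖ ⊗[K] A) k = op (1 : A) ⊗ₜ[K] algebraMap K A k := by
          rw [Algebra.TensorProduct.algebraMap_apply, Algebra.algebraMap_eq_smul_one,
            Algebra.algebraMap_eq_smul_one, TensorProduct.smul_tmul, op_one]
        rw [← h1] at h
        exact h }
    ⟨fun c c' h => by
      have h1 : toDual χ M (c (1 : A)) = toDual χ M (c' (1 : A)) := congrArg Subtype.val h
      have h2 := (toDual χ M).injective h1
      refine ModuleCat.hom_ext (LinearMap.ext fun a => ?_)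
      exact (map_eq_smul_map_one χ c a).trans
        ((congrArg _ h2).trans (map_eq_smul_map_one χ c' a).symm),
    fun φ => by
      let F : A →+ dualBimod χ M := AddMonoidHom.mk' (fun a => (toDual χ M).symm (χ a • φ.1))
        (fun a b => by rw [map_add, add_smul, map_add])
      refine ⟨homMk (X := bimod K A) F (fun a b p => ?_), ?_⟩
      · apply (toDual χ M).injective
        ext m
        rw [toDual_tmul_smul]
        have key : ∀ p : A, χ ((op a ⊗ₜ[K] b) • p) * φ.1 m =
            χ b * (χ p * φ.1 (a • m)) := fun p => by
          rw [φ.2, TensorProduct.Algebra.smul_def, op_smul_eq_mul, smul_eq_mul, map_mul, map_mul]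
          ring
        exact key p
      · refine Subtype.ext (LinearMap.ext fun m => ?_)
        change χ 1 * φ.1 m = φ.1 m
        rw [map_one, one_mul]⟩

end

variable (Q : ℕ → Type) [∀ n, AddCommGroup (Q n)] [∀ n, Module K (Q n)] [∀ n, Module A (Q n)]
  [∀ n, IsScalarTower K A (Q n)] (d : ∀ n, Q (n + 1) →ₗ[A] Q n)

/-- The short complex of bimodules dual to `0 → coker d (n+1) → Q n → coker d n → 0`. -/
noncomputable def syzygyShortComplex (hd : ∀ n, LinearMap.ker (d n) = LinearMap.range (d (n + 1)))
    (n : ℕ) : ShortComplex (ModuleCat (Aᵐᵒᵖ ⊗[K] A)) :=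
  ShortComplex.mk (X₁ := dualBimod χ (Q n ⧸ LinearMap.range (d n))) (X₂ := dualBimod χ (Q n))
    (X₃ := dualBimod χ (Q (n + 1) ⧸ LinearMap.range (d (n + 1))))
    (dualMap χ (LinearMap.range (d n)).mkQ)
    (dualMap χ ((LinearMap.range (d (n + 1))).liftQ (d n) (hd n).ge))
    (by
      refine ModuleCat.hom_ext (LinearMap.ext fun φ => (toDual χ _).injective
        (LinearMap.ext fun v => ?_))
      obtain ⟨v, rfl⟩ := Submodule.mkQ_surjective _ v
      change toDual χ _ φ ((LinearMap.range (d n)).mkQ (d n v)) = 0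
      have h : (LinearMap.range (d n)).mkQ (d n v) = 0 :=
        (Submodule.Quotient.mk_eq_zero _).2 ⟨v, rfl⟩
      rw [h, map_zero])

lemma syzygyShortComplex_shortExact
    (hd : ∀ n, LinearMap.ker (d n) = LinearMap.range (d (n + 1))) (n : ℕ) :
    (syzygyShortComplex χ Q d hd n).ShortExact := by
  refine { exact := ?_, mono_f := ?_, epi_g := ?_ }
  · rw [ShortComplex.moduleCat_exact_iff]
    intro φ hφ
    have h1 : ∀ v, toDual χ (Q n) φ (d n v) = 0 := fun v =>
      congrArg (fun ψ => toDual χ _ ψ (Submodule.mkQ _ v)) hφ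
    have h2 : ((LinearMap.range (d n)).restrictScalars K) ≤
        LinearMap.ker (toDual χ (Q n) φ) := by
      rintro _ ⟨v, rfl⟩
      exact h1 v
    refine ⟨(toDual χ _).symm (((LinearMap.range (d n)).restrictScalars K).liftQ _ h2), ?_⟩
    rfl
  · rw [ModuleCat.mono_iff_injective]
    intro φ ψ h
    refine (toDual χ _).injective (LinearMap.ext fun v => ?_)
    obtain ⟨v, rfl⟩ := Submodule.mkQ_surjective _ v
    exact congrArg (fun ψ => toDual χ (Q n) ψ v) h
  · rw [ModuleCat.epi_iff_surjective]
    intro φ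
    let f := (LinearMap.range (d (n + 1))).liftQ (d n) (hd n).ge
    have hf : LinearMap.ker (f.restrictScalars K) = ⊥ := by
      refine LinearMap.ker_eq_bot.2 ?_
      have : LinearMap.ker f = ⊥ := Submodule.ker_liftQ_eq_bot _ _ _ (hd n).le
      exact (LinearMap.ker_eq_bot (f := f)).1 this
    obtain ⟨g, hg⟩ := (f.restrictScalars K).exists_leftInverse_of_injective hf
    refine ⟨(toDual χ (Q n)).symm ((toDual χ _ φ).comp g), ?_⟩
    refine (toDual χ _).injective (LinearMap.ext fun v => ?_)
    exact congrArg (toDual χ _ φ) (LinearMap.congr_fun hg v)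

variable {Q d}

/-- Semi-invariant functionals on `Q n` all descend to the cokernel of a minimal differential. -/
noncomputable def chiHomQuotEquiv (hmin : ∀ n, ∀ φ ∈ chiHom χ (Q n), ∀ v, φ (d n v) = 0) (n : ℕ) :
    chiHom χ (Q n ⧸ LinearMap.range (d n)) ≃ₗ[K] chiHom χ (Q n) :=
  LinearEquiv.ofBijective
    { toFun := fun φ => ⟨φ.1.comp ((LinearMap.range (d n)).mkQ.restrictScalars K),
        fun a m => φ.2 a ((LinearMap.range (d n)).mkQ m)⟩
      map_add' := fun _ _ => rfl
      map_smul' := fun _ _ => rfl }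
    ⟨fun φ ψ h => by
      refine Subtype.ext (LinearMap.ext fun v => ?_)
      obtain ⟨v, rfl⟩ := Submodule.mkQ_surjective _ v
      exact congrArg (fun φ : chiHom χ (Q n) => φ.1 v) h,
    fun φ => by
      have h2 : ((LinearMap.range (d n)).restrictScalars K) ≤ LinearMap.ker φ.1 := by
        rintro _ ⟨v, rfl⟩
        exact hmin n φ.1 φ.2 v
      refine ⟨⟨((LinearMap.range (d n)).restrictScalars K).liftQ _ h2, fun a v => ?_⟩, rfl⟩
      obtain ⟨v, rfl⟩ := Submodule.mkQ_surjective _ v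
      exact φ.2 a v⟩

theorem finrank_ext_eq (hd : ∀ n, LinearMap.ker (d n) = LinearMap.range (d (n + 1)))
    (hQ : ∀ n, HasDualBasis A (Q n))
    (hmin : ∀ n, ∀ φ ∈ chiHom χ (Q n), ∀ v, φ (d n v) = 0) (n : ℕ) :
    Module.finrank K (((Ext K (ModuleCat (Aᵐᵒᵖ ⊗[K] A)) n).obj (Opposite.op (bimod K A))).obj
      (dualBimod χ (Q 0 ⧸ LinearMap.range (d 0)))) = Module.finrank K (chiHom χ (Q n)) := by
  let P := projectiveResolution (bimod K A)
  rw [(P.isoExt n _).toLinearEquiv.finrank_eq]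
  have key : ∀ n m, Module.finrank K ((P.complex.linearYonedaObj K
      (dualBimod χ (Q m ⧸ LinearMap.range (d m)))).homology n) =
      Module.finrank K (chiHom χ (Q (m + n))) := by
    intro n
    induction n with
    | zero =>
      intro m
      rw [finrank_homology_zero]
      exact ((homBimodEquiv χ _).trans (chiHomQuotEquiv χ hmin m)).finrank_eq
    | succ n ih =>
      intro m
      have h := finrank_homology_shift (K := K) P (syzygyShortComplex_shortExact χ Q d hd m)
        (fun n => isZero_homology_succ χ (hQ m) P n) (fun c => ?_) n
      · refine h.trans ((ih (m + 1)).trans ?_)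
        rw [show m + 1 + n = m + (n + 1) by omega]
      · refine (homBimodEquiv χ (Q (m + 1) ⧸ LinearMap.range (d (m + 1)))).injective ?_
        refine Eq.trans ?_
          (map_zero (homBimodEquiv χ (Q (m + 1) ⧸ LinearMap.range (d (m + 1))))).symm
        refine Subtype.ext (LinearMap.ext fun v => ?_)
        obtain ⟨v, rfl⟩ := Submodule.mkQ_surjective _ v
        exact hmin m _ (toDual_map_one_mem χ c) v
  rw [key, Nat.zero_add]

end Resolution

/-- Two elements with `x y = y x = 0` and `x ^ p = y ^ q` whose right multiplications are exact in
the sense needed for the zigzag complexes. -/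
structure ExactPair {A : Type} [Ring A] (x y : A) (p q : ℕ) : Prop where
  two_le_left : 2 ≤ p
  two_le_right : 2 ≤ q
  mul_eq_zero : x * y = 0
  mul_eq_zero' : y * x = 0
  pow_eq : x ^ p = y ^ q
  exists_of_mul_left : ∀ v, v * x = 0 → ∃ u, v = u * y
  exists_of_mul_right : ∀ v, v * y = 0 → ∃ u, v = u * x
  inter : ∀ v w, v * x = w * y → ∃ u, v * x = u * x ^ p

namespace ExactPair
variable {A : Type} [Ring A] {x y : A} {p q : ℕ}

lemma symm (h : ExactPair x y p q) : ExactPair y x q p where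
  two_le_left := h.two_le_right
  two_le_right := h.two_le_left
  mul_eq_zero := h.mul_eq_zero'
  mul_eq_zero' := h.mul_eq_zero
  pow_eq := h.pow_eq.symm
  exists_of_mul_left := h.exists_of_mul_right
  exists_of_mul_right := h.exists_of_mul_left
  inter v w hvw := by
    obtain ⟨u, hu⟩ := h.inter w v hvw.symm
    exact ⟨u, by rw [hvw, hu, h.pow_eq]⟩

lemma pow_mul_pow (h : ExactPair x y p q) {a b : ℕ} (ha : 1 ≤ a) (hb : 1 ≤ b) :
    x ^ a * y ^ b = 0 := by
  obtain ⟨a, rfl⟩ := Nat.exists_eq_add_of_le' ha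
  obtain ⟨b, rfl⟩ := Nat.exists_eq_add_of_le hb
  rw [pow_succ, pow_add, pow_one, mul_assoc, ← mul_assoc x, h.mul_eq_zero, zero_mul, mul_zero]

lemma exists_of_mul_pow (h : ExactPair x y p q) {a : ℕ} (ha : 1 ≤ a) (hap : a ≤ p) (v : A)
    (hv : v * x ^ a = 0) : ∃ u w, v = u * y + w * x ^ (p - a + 1) := by
  induction a, ha using Nat.le_induction generalizing v with
  | base =>
    rw [pow_one] at hv
    obtain ⟨u, rfl⟩ := h.exists_of_mul_left v hv
    exact ⟨u, 0, by simp⟩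
  | succ a ha ih =>
    obtain ⟨u, w, huw⟩ := ih (by omega) (v * x) (by rw [mul_assoc, ← pow_succ', hv])
    have h1 : (v - w * x ^ (p - a)) * x = u * y := by
      rw [sub_mul, mul_assoc w, ← pow_succ, huw]; abel
    obtain ⟨u', hu'⟩ := h.inter _ _ h1
    have h2 : (v - w * x ^ (p - a) - u' * x ^ (p - 1)) * x = 0 := by
      rw [sub_mul, hu', mul_assoc u', ← pow_succ,
        Nat.sub_add_cancel (by have := h.two_le_left; omega),
        sub_self]
    obtain ⟨u'', hu''⟩ := h.exists_of_mul_left _ h2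
    refine ⟨u'', w + u' * x ^ (a - 1), ?_⟩
    rw [show p - (a + 1) + 1 = p - a by omega, add_mul, mul_assoc, ← pow_add,
      show a - 1 + (p - a) = p - 1 by omega, ← hu'']
    abel

lemma exists_of_mul_pow_of_mul_pow (h : ExactPair x y p q) {a b : ℕ} (ha : 1 ≤ a) (hap : a ≤ p)
    (hb : 1 ≤ b) (hbq : b < q) (v : A) (hv : v * x ^ a = 0) (hv' : v * y ^ b = 0) :
    ∃ u w, v = u * x ^ (p - a + 1) + w * y ^ (q - b + 1) := by
  obtain ⟨u, w, rfl⟩ := h.exists_of_mul_pow ha hap v hv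
  have h1 : u * y ^ (b + 1) = 0 := by
    rw [add_mul, mul_assoc, mul_assoc, h.pow_mul_pow (by omega) hb, mul_zero, add_zero,
      ← pow_succ'] at hv'
    exact hv'
  obtain ⟨u', w', rfl⟩ := h.symm.exists_of_mul_pow (by omega) (by omega) u h1
  refine ⟨w, w', ?_⟩
  rw [add_mul, mul_assoc u', h.mul_eq_zero, mul_zero, zero_add, mul_assoc w', ← pow_succ,
    show q - (b + 1) + 1 + 1 = q - b + 1 by omega, add_comm]

/-- Exactness of the zigzag complex at one spot. -/
lemma exists_zigzag (h : ExactPair x y p q) (n : ℕ) (a b : ℕ → ℕ) (ha : ∀ j, 1 ≤ a j)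
    (hap : ∀ j, a j < p) (hb : ∀ j, 1 ≤ b j) (hbq : ∀ j, b j < q) (ha0 : a 0 = 1)
    (hbn : b (n + 1) = 1) (c : ℤ) (hc : c * c = 1) (w : ℕ → A)
    (hw : ∀ j ≤ n, w j * y ^ (q - b j) = c • (w (j + 1) * x ^ (p - a (j + 1)))) :
    ∃ v : ℕ → A, ∀ j ≤ n + 1, w j = v j * x ^ a j + c • (v (j + 1) * y ^ b j) := by
  have h1 : ∀ j, ∃ u, j ≤ n → w j * y ^ (q - b j) = u * y ^ q := by
    intro j
    by_cases hj : j ≤ n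
    · have e1 : w j * y ^ (q - b j) = w j * y ^ (q - b j - 1) * y := by
        rw [mul_assoc, ← pow_succ, Nat.sub_add_cancel (by have := hbq j; omega)]
      have e2 : c • (w (j + 1) * x ^ (p - a (j + 1))) =
          c • (w (j + 1) * x ^ (p - a (j + 1) - 1)) * x := by
        rw [smul_mul_assoc, mul_assoc, ← pow_succ,
          Nat.sub_add_cancel (by have := hap (j + 1); omega)]
      obtain ⟨u, hu⟩ := h.symm.inter _ _ (e1.symm.trans ((hw j hj).trans e2))
      exact ⟨u, fun _ => e1.trans hu⟩
    · exact ⟨0, fun h => absurd h hj⟩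
  choose u hu using h1
  have hyx : ∀ {i j}, 1 ≤ i → 1 ≤ j → y ^ i * x ^ j = 0 := fun hi hj => h.symm.pow_mul_pow hi hj
  have hxy : ∀ {i j}, 1 ≤ i → 1 ≤ j → x ^ i * y ^ j = 0 := fun hi hj => h.pow_mul_pow hi hj
  let v₁ : ℕ → A := fun j => j.casesOn 0 (fun j => c • u j)
  let w' : ℕ → A := fun j => w j - v₁ j * x ^ a j - u j * y ^ b j
  have hy : ∀ j ≤ n, w' j * y ^ (q - b j) = 0 := fun j hj => by
    have := hbq j
    simp only [w', sub_mul, mul_assoc, hxy (ha j) (show 1 ≤ q - b j by omega), ← pow_add, hu j hj,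
      Nat.add_sub_cancel' this.le]
    simp
  have hx : ∀ j ≤ n, w' (j + 1) * x ^ (p - a (j + 1)) = 0 := fun j hj => by
    have := hap (j + 1)
    have e : w (j + 1) * x ^ (p - a (j + 1)) = c • (u j * x ^ p) := by
      rw [h.pow_eq, ← hu j hj, hw j hj, smul_smul, hc, one_smul]
    simp only [w', v₁, sub_mul, mul_assoc, hyx (hb _) (show 1 ≤ p - a (j + 1) by omega), ← pow_add,
      Nat.add_sub_cancel' this.le, e]
    simp [mul_assoc]
  have hGH : ∀ j, ∃ G H, (j ≤ n + 1 → w' j = G * x ^ a j + H * y ^ b j) ∧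
      (1 ≤ j → G * y = 0) ∧ (j ≤ n → H * x = 0) := by
    intro j
    have hpa : ∀ j, p - (p - a j) + 1 = a j + 1 := fun j => by have := hap j; omega
    have hqb : ∀ j, q - (q - b j) + 1 = b j + 1 := fun j => by have := hbq j; omega
    rcases Nat.eq_zero_or_pos j with rfl | hj
    · obtain ⟨g, k, e⟩ := h.symm.exists_of_mul_pow (by have := hbq 0; omega) (by omega) _
        (hy 0 (by omega))
      rw [hqb] at e
      refine ⟨g, k * y, fun _ => ?_, fun h => by omega, fun _ => ?_⟩
      · rw [e, ha0, pow_one, mul_assoc k, ← pow_succ']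
      · rw [mul_assoc, h.mul_eq_zero', mul_zero]
    · obtain ⟨j, rfl⟩ := Nat.exists_eq_add_of_le' hj
      rcases lt_trichotomy j n with hjn | rfl | hjn
      · obtain ⟨g, k, e⟩ := h.exists_of_mul_pow_of_mul_pow
          (by have := hap (j + 1); omega) (by omega)
          (by have := hbq (j + 1); omega) (by have := hbq (j + 1); have := hb (j + 1); omega) _
          (hx j (by omega)) (hy (j + 1) (by omega))
        rw [hqb, hpa] at e
        refine ⟨g * x, k * y, fun _ => ?_, fun _ => ?_, fun _ => ?_⟩
        · rw [e, mul_assoc, mul_assoc k, ← pow_succ', ← pow_succ']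
        · rw [mul_assoc, h.mul_eq_zero, mul_zero]
        · rw [mul_assoc, h.mul_eq_zero', mul_zero]
      · obtain ⟨k, g, e⟩ := h.exists_of_mul_pow (by have := hap (j + 1); omega) (by omega) _
          (hx j le_rfl)
        rw [hpa] at e
        refine ⟨g * x, k, fun _ => ?_, fun _ => ?_, fun h => by omega⟩
        · rw [e, hbn, pow_one, mul_assoc g, ← pow_succ', add_comm]
        · rw [mul_assoc, h.mul_eq_zero, mul_zero]
      · exact ⟨0, 0, fun h => by omega, by simp, by simp⟩
  choose G H hw' hG hH using hGH
  let v₂ : ℕ → A := fun j => G j + j.casesOn 0 (fun j => c • H j)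
  refine ⟨fun j => v₁ j + v₂ j, fun j hj => ?_⟩
  have e1 : v₂ j * x ^ a j = G j * x ^ a j := by
    cases j with
    | zero => simp [v₂]
    | succ j =>
      obtain ⟨k, hk⟩ := Nat.exists_eq_add_of_le (ha (j + 1))
      simp only [v₂, add_mul, hk, pow_add, pow_one, smul_mul_assoc]
      rw [← mul_assoc (H j), hH j (by omega)]
      simp
  have e2 : v₂ (j + 1) * y ^ b j = c • (H j * y ^ b j) := by
    obtain ⟨k, hk⟩ := Nat.exists_eq_add_of_le (hb j)
    simp only [v₂, add_mul, hk, pow_add, pow_one, smul_mul_assoc]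
    rw [← mul_assoc (G _), hG (j + 1) (by omega)]
    simp
  have e3 : w j = w' j + v₁ j * x ^ a j + u j * y ^ b j := by simp only [w']; abel
  change w j = (v₁ j + v₂ j) * x ^ a j + c • ((v₁ (j + 1) + v₂ (j + 1)) * y ^ b j)
  rw [add_mul (v₁ j), add_mul (v₁ (j + 1)), e1, e2, e3, hw' j hj]
  simp only [v₁, smul_mul_assoc, smul_add, smul_smul, hc, one_smul]
  abel

end ExactPair

/-- The data from which the zigzag resolution is built: an exact pair together with an alternating
sequence of idempotents, commuting with `x` and shifted by `y`. -/
structure Zigzag (A : Type) [Ring A] where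
  (x y : A)
  (p q : ℕ)
  idem : ℕ → A
  exactPair : ExactPair x y p q
  even_q : Even q
  idem_mul_self : ∀ k, idem k * idem k = idem k
  idem_add_two : ∀ k, idem (k + 2) = idem k
  idem_mul_x : ∀ k, idem k * x = x * idem k
  idem_mul_y : ∀ k, idem k * y = y * idem (k + 1)

namespace Zigzag
variable {K : Type} [Field K] {A : Type} [Ring A] [Algebra K A] (Z : Zigzag A)

/-- The element occurring to the left in the differential starting in degree `n + 1`. -/
def z (n : ℕ) : A := if Even n then Z.x else Z.y

/-- The exponent attached to `z n`. -/
def e (n : ℕ) : ℕ := if Even n then Z.p else Z.q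

lemma z_add_two (n : ℕ) : Z.z (n + 2) = Z.z n := by simp [z, Nat.even_add]

lemma e_add_two (n : ℕ) : Z.e (n + 2) = Z.e n := by simp [e, Nat.even_add]

lemma exactPair_z (n : ℕ) : ExactPair (Z.z n) (Z.z (n + 1)) (Z.e n) (Z.e (n + 1)) := by
  by_cases h : Even n
  · simpa [z, e, h, Nat.even_add_one] using Z.exactPair
  · simpa [z, e, h, Nat.even_add_one] using Z.exactPair.symm

lemma two_le_e (n : ℕ) : 2 ≤ Z.e n := (Z.exactPair_z n).two_le_left

/-- Exponents of the left entries of the differential. -/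
def a (n j : ℕ) : ℕ := if j ≤ n / 2 then 1 else Z.e n - 1

/-- Exponents of the right entries of the differential. -/
def b (n j : ℕ) : ℕ := if j < (n + 1) / 2 then Z.e (n + 1) - 1 else 1

lemma one_le_a (n j : ℕ) : 1 ≤ Z.a n j := by
  have := Z.two_le_e n
  unfold a; split_ifs <;> omega

lemma a_lt (n j : ℕ) : Z.a n j < Z.e n := by
  have := Z.two_le_e n
  unfold a; split_ifs <;> omega

lemma one_le_b (n j : ℕ) : 1 ≤ Z.b n j := by
  have := Z.two_le_e (n + 1)
  unfold b; split_ifs <;> omega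

lemma b_lt (n j : ℕ) : Z.b n j < Z.e (n + 1) := by
  have := Z.two_le_e (n + 1)
  unfold b; split_ifs <;> omega

lemma b_succ_add_a (n j : ℕ) : Z.b (n + 1) j + Z.a n j = Z.e n := by
  have := Z.two_le_e n
  have : Z.e (n + 1 + 1) = Z.e n := Z.e_add_two n
  unfold a b
  split_ifs <;> omega

lemma a_succ_add_b (n j : ℕ) : Z.a (n + 1) (j + 1) + Z.b n j = Z.e (n + 1) := by
  have := Z.two_le_e (n + 1)
  unfold a b
  split_ifs <;> omega

lemma idem_mul_x_pow (k i : ℕ) : Z.idem k * Z.x ^ i = Z.x ^ i * Z.idem k :=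
  (show Commute (Z.idem k) Z.x from Z.idem_mul_x k).pow_right i

lemma idem_mul_y_pow (k i : ℕ) : Z.idem k * Z.y ^ i = Z.y ^ i * Z.idem (k + i) := by
  induction i with
  | zero => simp
  | succ i ih =>
    rw [pow_succ, ← mul_assoc, ih, mul_assoc, Z.idem_mul_y, mul_assoc, add_assoc]

lemma idem_add_two_mul (k i : ℕ) : Z.idem (k + 2 * i) = Z.idem k := by
  induction i with
  | zero => simp
  | succ i ih => rw [mul_add, mul_one, ← add_assoc, Z.idem_add_two, ih]

lemma idem_mul_y_pow_of_odd (k : ℕ) {i : ℕ} (hi : Odd i) :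
    Z.idem k * Z.y ^ i = Z.y ^ i * Z.idem (k + 1) := by
  obtain ⟨i, rfl⟩ := hi
  rw [idem_mul_y_pow, add_comm (2 * i), ← add_assoc, idem_add_two_mul]

lemma odd_q_sub_one : Odd (Z.q - 1) :=
  Nat.Even.sub_odd (by have := Z.exactPair.two_le_right; omega) Z.even_q odd_one

lemma idem_mul_z_pow_a (n j k : ℕ) : Z.idem ((n + 1) / 2 + k) * Z.z n ^ Z.a n j =
    Z.z n ^ Z.a n j * Z.idem (n / 2 + k) := by
  rcases Nat.even_or_odd n with h | h
  · rw [z, if_pos h, idem_mul_x_pow, show (n + 1) / 2 = n / 2 by grind]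
  · rw [z, if_neg (Nat.not_even_iff_odd.2 h), idem_mul_y_pow_of_odd,
      show (n + 1) / 2 + k + 1 = n / 2 + k + 2 by grind, Z.idem_add_two]
    rw [a, e, if_neg (Nat.not_even_iff_odd.2 h)]
    split_ifs
    exacts [odd_one, Z.odd_q_sub_one]

lemma idem_mul_z_pow_b (n j k : ℕ) : Z.idem ((n + 1) / 2 + (k + 1)) * Z.z (n + 1) ^ Z.b n j =
    Z.z (n + 1) ^ Z.b n j * Z.idem (n / 2 + k) := by
  rcases Nat.even_or_odd n with h | h
  · rw [z, if_neg (by simpa [Nat.even_add_one] using h), idem_mul_y_pow_of_odd,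
      show (n + 1) / 2 + (k + 1) + 1 = n / 2 + k + 2 by grind, Z.idem_add_two]
    have he : Z.e (n + 1) = Z.q := if_neg (by simpa [Nat.even_add_one] using h)
    rw [b, he]
    split_ifs
    exacts [Z.odd_q_sub_one, odd_one]
  · rw [z, if_pos (by simpa [Nat.even_add_one] using h), idem_mul_x_pow,
      show (n + 1) / 2 + (k + 1) = n / 2 + k + 2 by grind, Z.idem_add_two]

/-- The terms of the zigzag resolution. -/
def term (n : ℕ) : Submodule A (ℕ → A) where
  carrier := {v | ∀ j, v j * Z.idem (n / 2 + j) = v j ∧ (n < j → v j = 0)}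
  add_mem' {v w} hv hw j :=
    ⟨by simp [add_mul, (hv j).1, (hw j).1], fun hj => by simp [(hv j).2 hj, (hw j).2 hj]⟩
  zero_mem' := by simp
  smul_mem' c v hv j := ⟨by simp [mul_assoc, (hv j).1], fun hj => by simp [(hv j).2 hj]⟩

/-- The differential on sequences. -/
def dSeq (n : ℕ) : (ℕ → A) →ₗ[A] (ℕ → A) where
  toFun v j := if j ≤ n then
    v j * Z.z n ^ Z.a n j + (-1 : ℤ) ^ n • (v (j + 1) * Z.z (n + 1) ^ Z.b n j) else 0
  map_add' v w := by
    ext j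
    simp only [Pi.add_apply]
    split_ifs
    · rw [add_mul, add_mul, smul_add]; abel
    · simp
  map_smul' c v := by
    ext j
    simp only [Pi.smul_apply, smul_eq_mul, RingHom.id_apply]
    split_ifs
    · rw [mul_add, mul_smul_comm, mul_assoc, mul_assoc]
    · simp

lemma dSeq_apply_of_le {n j : ℕ} (v : ℕ → A) (hj : j ≤ n) : Z.dSeq n v j =
    v j * Z.z n ^ Z.a n j + (-1 : ℤ) ^ n • (v (j + 1) * Z.z (n + 1) ^ Z.b n j) := if_pos hj

lemma dSeq_apply_of_lt {n j : ℕ} (v : ℕ → A) (hj : n < j) : Z.dSeq n v j = 0 :=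
  if_neg (not_le.2 hj)

lemma dSeq_mem {n : ℕ} {v : ℕ → A} (hv : v ∈ Z.term (n + 1)) : Z.dSeq n v ∈ Z.term n := by
  refine fun j => ⟨?_, Z.dSeq_apply_of_lt v⟩
  by_cases hj : j ≤ n
  · rw [Z.dSeq_apply_of_le v hj, add_mul, smul_mul_assoc, mul_assoc, mul_assoc,
      ← Z.idem_mul_z_pow_a, ← Z.idem_mul_z_pow_b, ← mul_assoc, ← mul_assoc, (hv j).1,
      (hv (j + 1)).1]
  · rw [Z.dSeq_apply_of_lt v (not_le.1 hj), zero_mul]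

/-- The differential of the zigzag resolution. -/
def d (n : ℕ) : Z.term (n + 1) →ₗ[A] Z.term n := (Z.dSeq n).restrict fun _ => Z.dSeq_mem

lemma coe_d (n : ℕ) (v : Z.term (n + 1)) : (Z.d n v : ℕ → A) = Z.dSeq n v := rfl

lemma dSeq_dSeq (n : ℕ) (v : ℕ → A) : Z.dSeq n (Z.dSeq (n + 1) v) = 0 := by
  funext j
  by_cases hj : j ≤ n
  · rw [Z.dSeq_apply_of_le _ hj, Z.dSeq_apply_of_le _ (by omega), Z.dSeq_apply_of_le _ (by omega),
      z_add_two]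
    have h := Z.exactPair_z n
    simp only [add_mul, smul_mul_assoc, mul_assoc, ← pow_add, b_succ_add_a, a_succ_add_b,
      h.symm.pow_mul_pow (Z.one_le_a _ _) (Z.one_le_a _ _),
      h.pow_mul_pow (Z.one_le_b _ _) (Z.one_le_b _ _), h.pow_eq]
    simp [pow_succ]
  · rw [Z.dSeq_apply_of_lt _ (not_le.1 hj)]; rfl

lemma ker_d (n : ℕ) : LinearMap.ker (Z.d n) = LinearMap.range (Z.d (n + 1)) := by
  refine le_antisymm (fun w hw => ?_) ?_
  · have hw0 : Z.dSeq n w = 0 := congrArg Subtype.val hw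
    obtain ⟨v, hv⟩ := (Z.exactPair_z (n + 1)).exists_zigzag n (Z.a (n + 1)) (Z.b (n + 1))
      (Z.one_le_a _) (Z.a_lt _) (Z.one_le_b _) (Z.b_lt _) (by simp [a])
      (by rw [b, if_neg (by omega)]) ((-1) ^ (n + 1)) (by rw [← mul_pow]; simp) w (fun j hj => by
        have h := congrFun hw0 j
        rw [Z.dSeq_apply_of_le _ hj] at h
        have e1 := Z.b_succ_add_a n j
        have e2 := Z.a_succ_add_b n j
        rw [z_add_two, e_add_two, show Z.e n - Z.b (n + 1) j = Z.a n j by omega,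
          show Z.e (n + 1) - Z.a (n + 1) (j + 1) = Z.b n j by omega, eq_neg_of_add_eq_zero_left h,
          pow_succ]
        simp)
    let v' : ℕ → A := fun j => if j ≤ n + 2 then v j * Z.idem ((n + 2) / 2 + j) else 0
    have hv' : v' ∈ Z.term (n + 2) := fun j => by
      by_cases hj : j ≤ n + 2
      · simp only [v', if_pos hj, mul_assoc, Z.idem_mul_self, true_and]
        intro h; omega
      · simp [v', hj]
    refine ⟨⟨v', hv'⟩, Subtype.ext (funext fun j => ?_)⟩
    rw [coe_d]
    by_cases hj : j ≤ n + 1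
    · rw [Z.dSeq_apply_of_le _ hj]
      simp only [v', if_pos (show j ≤ n + 2 by omega), if_pos (show j + 1 ≤ n + 2 by omega)]
      rw [mul_assoc, mul_assoc, Z.idem_mul_z_pow_a (n + 1), Z.idem_mul_z_pow_b (n + 1), ← mul_assoc,
        ← mul_assoc, ← smul_mul_assoc, ← add_mul, ← hv j hj, (w.2 j).1]
    · rw [Z.dSeq_apply_of_lt _ (not_le.1 hj), (w.2 j).2 (not_le.1 hj)]
  · rintro _ ⟨v, rfl⟩
    exact Subtype.ext (Z.dSeq_dSeq n v)

/-- The generators of the terms. -/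
def gen (n j : ℕ) : Z.term n := ⟨Pi.single j (if j ≤ n then Z.idem (n / 2 + j) else 0), fun i => by
  rcases eq_or_ne i j with rfl | h
  · simp only [Pi.single_eq_same]
    split_ifs
    · exact ⟨Z.idem_mul_self _, fun h => by omega⟩
    · simp
  · simp [h]⟩

lemma sum_smul_gen (n : ℕ) (v : Z.term n) :
    ∑ j ∈ Finset.range (n + 1), v.1 j • Z.gen n j = v := by
  refine Subtype.ext (funext fun i => ?_)
  simp only [Submodule.coe_sum, Submodule.coe_smul, gen, Finset.sum_apply, Pi.smul_apply,
    Pi.single_apply, smul_eq_mul, mul_ite, mul_zero, Finset.sum_ite_eq, Finset.mem_range]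
  split_ifs with h h'
  · exact (v.2 i).1
  · omega
  · exact ((v.2 i).2 (by omega)).symm

lemma hasDualBasis (n : ℕ) : HasDualBasis A (Z.term n) :=
  ⟨n + 1, fun j => Z.gen n j, fun j => (LinearMap.proj (j : ℕ)).comp (Z.term n).subtype, fun v => by
    simp only [LinearMap.comp_apply, LinearMap.proj_apply, Submodule.subtype_apply]
    rw [Fin.sum_univ_eq_sum_range (fun j => v.1 j • Z.gen n j)]
    exact Z.sum_smul_gen n v⟩

variable (χ : A →ₐ[K] K)

lemma chiHom_apply {n : ℕ} {φ : Module.Dual K (Z.term n)} (hφ : φ ∈ chiHom χ (Z.term n))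
    (v : Z.term n) : φ v = ∑ j ∈ Finset.range (n + 1), χ (v.1 j) * φ (Z.gen n j) := by
  conv_lhs => rw [← Z.sum_smul_gen n v, map_sum]
  exact Finset.sum_congr rfl fun j _ => hφ _ _

lemma chiHom_d (hx : χ Z.x = 0) (hy : χ Z.y = 0) (n : ℕ) (φ) (hφ : φ ∈ chiHom χ (Z.term n))
    (v : Z.term (n + 1)) : φ (Z.d n v) = 0 := by
  have hz : ∀ n, χ (Z.z n) = 0 := fun n => by unfold z; split_ifs <;> assumption
  rw [Z.chiHom_apply χ hφ]
  refine Finset.sum_eq_zero fun j hj => ?_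
  have h1 := Z.one_le_a n j
  have h2 := Z.one_le_b n j
  rw [coe_d, Z.dSeq_apply_of_le _ (by simpa [Nat.lt_succ_iff] using hj), map_add, map_zsmul,
    map_mul, map_mul, map_pow, map_pow, hz, hz, zero_pow (by omega), zero_pow (by omega)]
  simp

open Classical in
/-- The positions at which the character does not vanish. -/
noncomputable def support (n : ℕ) : Finset ℕ :=
  (Finset.range (n + 1)).filter fun j => χ (Z.idem (n / 2 + j)) = 1

lemma mem_support {n j : ℕ} : j ∈ Z.support χ n ↔ j ≤ n ∧ χ (Z.idem (n / 2 + j)) = 1 := by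
  simp [support]

lemma chi_idem (k : ℕ) : χ (Z.idem k) = 0 ∨ χ (Z.idem k) = 1 := by
  have h := congrArg χ (Z.idem_mul_self k)
  rw [map_mul] at h
  exact IsIdempotentElem.iff_eq_zero_or_one.1 h

lemma chiHom_gen_eq_zero {n : ℕ} {φ : Module.Dual K (Z.term n)} (hφ : φ ∈ chiHom χ (Z.term n))
    {j : ℕ} (hj : j ≤ n) (hjs : j ∉ Z.support χ n) : φ (Z.gen n j) = 0 := by
  have h0 : χ (Z.idem (n / 2 + j)) = 0 :=
    (Z.chi_idem χ _).resolve_right fun h => hjs ((Z.mem_support χ).2 ⟨hj, h⟩)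
  have h1 : Z.idem (n / 2 + j) • Z.gen n j = Z.gen n j := by
    refine Subtype.ext (funext fun i => ?_)
    simp only [Submodule.coe_smul, gen, if_pos hj, Pi.smul_apply, Pi.single_apply]
    split_ifs
    · exact Z.idem_mul_self _
    · simp
  rw [← h1, hφ, h0, zero_mul]

lemma finrank_chiHom (n : ℕ) :
    Module.finrank K (chiHom χ (Z.term n)) = (Z.support χ n).card := by
  let F : chiHom χ (Z.term n) →ₗ[K] (Z.support χ n → K) :=
    { toFun := fun φ j => φ.1 (Z.gen n j)
      map_add' := fun _ _ => rfl
      map_smul' := fun _ _ => rfl }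
  have hF : Function.Bijective F := by
    constructor
    · refine fun φ ψ h => Subtype.ext (LinearMap.ext fun v => ?_)
      rw [Z.chiHom_apply χ φ.2, Z.chiHom_apply χ ψ.2]
      refine Finset.sum_congr rfl fun j hj => ?_
      by_cases hjs : j ∈ Z.support χ n
      · rw [show φ.1 (Z.gen n j) = ψ.1 (Z.gen n j) from congrFun h ⟨j, hjs⟩]
      · have hj : j ≤ n := by simpa [Nat.lt_succ_iff] using hj
        rw [Z.chiHom_gen_eq_zero χ φ.2 hj hjs, Z.chiHom_gen_eq_zero χ ψ.2 hj hjs]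
    · intro c
      let φ : Module.Dual K (Z.term n) :=
        { toFun := fun v => ∑ j : Z.support χ n, χ (v.1 j) * c j
          map_add' := fun v w => by simp [add_mul, Finset.sum_add_distrib]
          map_smul' := fun k v => by simp [Finset.mul_sum, mul_assoc] }
      refine ⟨⟨φ, fun a v => ?_⟩, funext fun j => ?_⟩
      · simp [φ, Finset.mul_sum, mul_assoc]
      · change ∑ i : Z.support χ n, χ ((Z.gen n j).1 i) * c i = c j
        obtain ⟨h1, h2⟩ := (Z.mem_support χ).1 j.2
        rw [Finset.sum_eq_single j (fun i _ hi => ?_) (by simp)]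
        · simp [gen, h1, h2]
        · simp [gen, Subtype.coe_injective.ne hi]
  rw [(LinearEquiv.ofBijective F hF).finrank_eq, Module.finrank_fintype_fun_eq_card,
    Fintype.card_coe]

open CategoryTheory TensorProduct in
theorem finrank_ext (hx : χ Z.x = 0) (hy : χ Z.y = 0) (n : ℕ) :
    Module.finrank K (((Ext K (ModuleCat (Aᵐᵒᵖ ⊗[K] A)) n).obj (Opposite.op (bimod K A))).obj
      (dualBimod χ (Z.term 0 ⧸ LinearMap.range (Z.d 0)))) = (Z.support χ n).card :=
  (finrank_ext_eq χ Z.ker_d Z.hasDualBasis (Z.chiHom_d χ hx hy) n).trans (Z.finrank_chiHom χ n)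

end Zigzag

section Local
open Polynomial
variable {K : Type} [Field K] {A : Type} [Ring A] [Algebra K A] {e f x y : A} {p q : ℕ}

lemma X_pow_dvd_of_mul_aeval_eq_zero (hx : x ^ (p + 1) = 0) (he : e * x ^ p ≠ 0) (G : K[X])
    (hG : e * aeval x G = 0) : X ^ (p + 1) ∣ G := by
  rw [X_pow_dvd_iff]
  intro d
  induction d using Nat.strong_induction_on with
  | _ d ih =>
    intro hd
    obtain ⟨U, rfl⟩ := X_pow_dvd_iff.2 fun i hi => ih i hi (hi.trans hd)
    rw [coeff_X_pow_mul', if_pos le_rfl, Nat.sub_self]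
    have h1 : e * x ^ p * algebraMap K A (U.coeff 0) = 0 := by
      have h2 : aeval x U * x ^ p = x ^ p * algebraMap K A (U.coeff 0) := by
        conv_lhs => rw [← divX_mul_X_add U]
        rw [map_add, map_mul, aeval_X, aeval_C, add_mul, mul_assoc, ← pow_succ', hx, mul_zero,
          zero_add, Algebra.commutes]
      rw [mul_assoc, ← h2, show x ^ p = x ^ d * x ^ (p - d) by rw [← pow_add]; congr 1; omega,
        ← mul_assoc, ← mul_assoc]
      have h3 : aeval x U * x ^ d = aeval x (X ^ d * U) := by
        rw [mul_comm, map_mul, map_pow, aeval_X]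
      rw [mul_assoc e, h3, hG, zero_mul]
    by_contra hU
    apply he
    rw [← Algebra.commutes, ← Algebra.smul_def] at h1
    exact (smul_eq_zero.1 h1).resolve_left hU

/-- Two orthogonal idempotents and two elements spanning `A` as in a local biserial algebra. -/
structure IsBiserial (K : Type) [Field K] {A : Type} [Ring A] [Algebra K A] (e f x y : A)
    (p q : ℕ) : Prop where
  two_le_left : 2 ≤ p
  two_le_right : 2 ≤ q
  mul_eq_zero : x * y = 0
  mul_eq_zero' : y * x = 0
  pow_eq : x ^ p = y ^ q
  e_mul_e : e * e = e
  e_mul_f : e * f = 0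
  f_mul_e : f * e = 0
  f_mul_f : f * f = f
  e_mul_pow : e * x ^ p ≠ 0
  f_mul_pow : f * x ^ p ≠ 0
  exists_eq : ∀ v : A, ∃ P Q P' Q' : K[X],
    v = e * (aeval x P + aeval y Q) + f * (aeval x P' + aeval y Q')

namespace IsBiserial

lemma symm (h : IsBiserial K e f x y p q) : IsBiserial K e f y x q p where
  two_le_left := h.two_le_right
  two_le_right := h.two_le_left
  mul_eq_zero := h.mul_eq_zero'
  mul_eq_zero' := h.mul_eq_zero
  pow_eq := h.pow_eq.symm
  e_mul_e := h.e_mul_e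
  e_mul_f := h.e_mul_f
  f_mul_e := h.f_mul_e
  f_mul_f := h.f_mul_f
  e_mul_pow := h.pow_eq ▸ h.e_mul_pow
  f_mul_pow := h.pow_eq ▸ h.f_mul_pow
  exists_eq v := by
    obtain ⟨P, Q, P', Q', hv⟩ := h.exists_eq v
    exact ⟨Q, P, Q', P', by rw [hv, add_comm (aeval x P), add_comm (aeval x P')]⟩

lemma exists_eq' (h : IsBiserial K e f x y p q) (v : A) : ∃ (P P' : K[X]) (u : A),
    v = e * aeval x P + f * aeval x P' + u * y := by
  obtain ⟨P, Q, P', Q', hv⟩ := h.exists_eq v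
  refine ⟨P + C (Q.coeff 0), P' + C (Q'.coeff 0),
    e * aeval y Q.divX + f * aeval y Q'.divX, ?_⟩
  have h1 : ∀ Q : K[X], aeval y Q = aeval y Q.divX * y + algebraMap K A (Q.coeff 0) := fun Q => by
    conv_lhs => rw [← divX_mul_X_add Q]
    simp
  rw [hv, h1 Q, h1 Q']
  simp only [map_add, aeval_C, mul_add, add_mul, mul_assoc]
  abel

lemma X_pow_dvd (h : IsBiserial K e f x y p q) {P P' : K[X]} {u : A} {k : ℕ} (hk : 1 ≤ k)
    (hv : (e * aeval x P + f * aeval x P' + u * y) * x ^ k = 0) :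
    X ^ (p + 1) ∣ P * X ^ k ∧ X ^ (p + 1) ∣ P' * X ^ k := by
  have hx : x ^ (p + 1) = 0 := by
    obtain ⟨q, rfl⟩ := Nat.exists_eq_add_of_le' (le_trans one_le_two h.two_le_right)
    rw [pow_succ, h.pow_eq, pow_succ, mul_assoc, h.mul_eq_zero', mul_zero]
  have h1 : e * aeval x (P * X ^ k) + f * aeval x (P' * X ^ k) = 0 := by
    obtain ⟨k, rfl⟩ := Nat.exists_eq_add_of_le hk
    have : u * y * x ^ (1 + k) = 0 := by
      rw [pow_add, pow_one, mul_assoc, ← mul_assoc y, h.mul_eq_zero', zero_mul, mul_zero]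
    rw [add_mul, this, add_zero, add_mul] at hv
    simpa [mul_assoc] using hv
  constructor
  · apply X_pow_dvd_of_mul_aeval_eq_zero hx h.e_mul_pow
    have := congrArg (e * ·) h1
    simpa [mul_add, ← mul_assoc, h.e_mul_e, h.e_mul_f] using this
  · apply X_pow_dvd_of_mul_aeval_eq_zero hx h.f_mul_pow
    have := congrArg (f * ·) h1
    simpa [mul_add, ← mul_assoc, h.f_mul_e, h.f_mul_f] using this

lemma exists_of_mul (h : IsBiserial K e f x y p q) (v : A) (hv : v * x = 0) :
    ∃ u, v = u * y := by
  obtain ⟨P, P', u, rfl⟩ := h.exists_eq' v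
  obtain ⟨⟨R, hR⟩, ⟨R', hR'⟩⟩ := h.X_pow_dvd le_rfl (by rwa [pow_one])
  have key : ∀ {P R : K[X]}, P * X ^ 1 = X ^ (p + 1) * R → aeval x P = aeval x R * x ^ p :=
    fun {P R} hR => by
    have : P = R * X ^ p := by
      apply mul_right_cancel₀ (X_ne_zero (R := K))
      rw [pow_one] at hR
      rw [hR]; ring
    rw [this, map_mul, map_pow, aeval_X]
  have hq : y ^ q = y ^ (q - 1) * y := by
    rw [← pow_succ, Nat.sub_add_cancel (le_trans one_le_two h.two_le_right)]
  refine ⟨(e * aeval x R + f * aeval x R') * y ^ (q - 1) + u, ?_⟩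
  rw [key hR, key hR', h.pow_eq, add_mul, mul_assoc _ (y ^ (q - 1)), ← hq, add_mul, mul_assoc,
    mul_assoc]

lemma inter (h : IsBiserial K e f x y p q) (v w : A) (hv : v * x = w * y) :
    ∃ u, v * x = u * x ^ p := by
  obtain ⟨P, P', u, rfl⟩ := h.exists_eq' v
  obtain ⟨⟨R, hR⟩, ⟨R', hR'⟩⟩ := h.X_pow_dvd (k := 2) (by omega)
    (by rw [pow_two, ← mul_assoc, hv, mul_assoc, h.mul_eq_zero', mul_zero])
  obtain ⟨p, rfl⟩ := Nat.exists_eq_add_of_le' (le_trans one_le_two h.two_le_left)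
  have key : ∀ {P R : K[X]}, P * X ^ 2 = X ^ (p + 1 + 1) * R → aeval x P * x =
      aeval x R * x ^ (p + 1) := fun {P R} hR => by
    have : P = R * X ^ p := by
      apply mul_right_cancel₀ (pow_ne_zero 2 (X_ne_zero (R := K)))
      rw [hR]; ring
    rw [this, map_mul, map_pow, aeval_X, pow_succ, mul_assoc]
  refine ⟨e * aeval x R + f * aeval x R', ?_⟩
  rw [add_mul, add_mul, mul_assoc, mul_assoc, mul_assoc u, key hR, key hR', h.mul_eq_zero',
    mul_zero, add_zero, add_mul, mul_assoc, mul_assoc]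

lemma exactPair (h : IsBiserial K e f x y p q) : ExactPair x y p q where
  two_le_left := h.two_le_left
  two_le_right := h.two_le_right
  mul_eq_zero := h.mul_eq_zero
  mul_eq_zero' := h.mul_eq_zero'
  pow_eq := h.pow_eq
  exists_of_mul_left := h.exists_of_mul
  exists_of_mul_right := h.symm.exists_of_mul
  inter := h.inter

end IsBiserial
end Local

section Lambda
open Polynomial

lemma add_pow_of_mul_eq_zero {A : Type} [Ring A] {a b : A} (hab : a * b = 0) (hba : b * a = 0)
    (n : ℕ) : (a + b) ^ (n + 1) = a ^ (n + 1) + b ^ (n + 1) := by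
  induction n with
  | zero => simp
  | succ n ih =>
    rw [pow_succ, ih, add_mul, mul_add, mul_add, pow_succ a n, mul_assoc _ a b, hab,
      pow_succ b n, mul_assoc _ b a, hba]
    simp [pow_succ]

variable (K : Type) [Field K] (r s : ℕ)

/-- The generators of `Λ`. -/
noncomputable def lam (g : Gen) : LambdaAlg K r s :=
  RingQuot.mkAlgHom K (RelL K r s) (FreeAlgebra.ι K g)

/-- The sum of the two loops. -/
noncomputable def lamX : LambdaAlg K r s := lam K r s .ep + lam K r s .eb

/-- The sum of the two arrows between distinct vertices. -/
noncomputable def lamY : LambdaAlg K r s := lam K r s .al + lam K r s .ab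

variable {K r s}

lemma lam_rel {a b : FreeAlgebra K Gen} (h : RelL K r s a b) :
    RingQuot.mkAlgHom K (RelL K r s) a = RingQuot.mkAlgHom K (RelL K r s) b :=
  RingQuot.mkAlgHom_rel K h

lemma lam_e1_add_e2 : lam K r s .e1 + lam K r s .e2 = 1 := by
  simpa [lam] using lam_rel (RelL.sum (K := K) (r := r) (s := s))

lemma lam_e1_mul_e1 : lam K r s .e1 * lam K r s .e1 = lam K r s .e1 := by
  simpa [lam] using lam_rel (RelL.idem1 (K := K) (r := r) (s := s))

lemma lam_e2_mul_e2 : lam K r s .e2 * lam K r s .e2 = lam K r s .e2 := by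
  simpa [lam] using lam_rel (RelL.idem2 (K := K) (r := r) (s := s))

lemma lam_e1_mul_e2 : lam K r s .e1 * lam K r s .e2 = 0 := by
  simpa [lam] using lam_rel (RelL.orth12 (K := K) (r := r) (s := s))

lemma lam_e2_mul_e1 : lam K r s .e2 * lam K r s .e1 = 0 := by
  simpa [lam] using lam_rel (RelL.orth21 (K := K) (r := r) (s := s))

lemma lam_mul_eq_zero {a b e f : LambdaAlg K r s} (ha : a * e = a) (hb : f * b = b)
    (hef : e * f = 0) : a * b = 0 := by
  rw [← ha, ← hb, mul_assoc, ← mul_assoc e, hef, zero_mul, mul_zero]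

lemma lam_e1_mul_ep : lam K r s .e1 * lam K r s .ep = lam K r s .ep := by
  simpa [lam] using lam_rel (RelL.ep_l (K := K) (r := r) (s := s))

lemma lam_ep_mul_e1 : lam K r s .ep * lam K r s .e1 = lam K r s .ep := by
  simpa [lam] using lam_rel (RelL.ep_r (K := K) (r := r) (s := s))

lemma lam_e2_mul_eb : lam K r s .e2 * lam K r s .eb = lam K r s .eb := by
  simpa [lam] using lam_rel (RelL.eb_l (K := K) (r := r) (s := s))

lemma lam_eb_mul_e2 : lam K r s .eb * lam K r s .e2 = lam K r s .eb := by
  simpa [lam] using lam_rel (RelL.eb_r (K := K) (r := r) (s := s))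

lemma lam_e1_mul_al : lam K r s .e1 * lam K r s .al = lam K r s .al := by
  simpa [lam] using lam_rel (RelL.al_l (K := K) (r := r) (s := s))

lemma lam_al_mul_e2 : lam K r s .al * lam K r s .e2 = lam K r s .al := by
  simpa [lam] using lam_rel (RelL.al_r (K := K) (r := r) (s := s))

lemma lam_e2_mul_ab : lam K r s .e2 * lam K r s .ab = lam K r s .ab := by
  simpa [lam] using lam_rel (RelL.ab_l (K := K) (r := r) (s := s))

lemma lam_ab_mul_e1 : lam K r s .ab * lam K r s .e1 = lam K r s .ab := by
  simpa [lam] using lam_rel (RelL.ab_r (K := K) (r := r) (s := s))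

lemma lam_al_mul_eb : lam K r s .al * lam K r s .eb = 0 := by
  simpa [lam] using lam_rel (RelL.zero1 (K := K) (r := r) (s := s))

lemma lam_ep_mul_al : lam K r s .ep * lam K r s .al = 0 := by
  simpa [lam] using lam_rel (RelL.zero2 (K := K) (r := r) (s := s))

lemma lam_ab_mul_ep : lam K r s .ab * lam K r s .ep = 0 := by
  simpa [lam] using lam_rel (RelL.zero3 (K := K) (r := r) (s := s))

lemma lam_eb_mul_ab : lam K r s .eb * lam K r s .ab = 0 := by
  simpa [lam] using lam_rel (RelL.zero4 (K := K) (r := r) (s := s))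

lemma lam_ep_pow : lam K r s .ep ^ r = (lam K r s .al * lam K r s .ab) ^ s := by
  simpa [lam] using lam_rel (RelL.pow1 (K := K) (r := r) (s := s))

lemma lam_eb_pow : lam K r s .eb ^ r = (lam K r s .ab * lam K r s .al) ^ s := by
  simpa [lam] using lam_rel (RelL.pow2 (K := K) (r := r) (s := s))

lemma lamX_mul_lamY : lamX K r s * lamY K r s = 0 := by
  simp only [lamX, lamY, add_mul, mul_add, lam_ep_mul_al, lam_eb_mul_ab,
    lam_mul_eq_zero lam_ep_mul_e1 lam_e2_mul_ab lam_e1_mul_e2,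
    lam_mul_eq_zero lam_eb_mul_e2 lam_e1_mul_al lam_e2_mul_e1, add_zero]

lemma lamY_mul_lamX : lamY K r s * lamX K r s = 0 := by
  simp only [lamX, lamY, add_mul, mul_add, lam_al_mul_eb, lam_ab_mul_ep,
    lam_mul_eq_zero lam_al_mul_e2 lam_e1_mul_ep lam_e2_mul_e1,
    lam_mul_eq_zero lam_ab_mul_e1 lam_e2_mul_eb lam_e1_mul_e2, add_zero]

lemma lamX_pow (hr : 2 ≤ r) (hs : 1 ≤ s) : lamX K r s ^ r = lamY K r s ^ (2 * s) := by
  obtain ⟨r, rfl⟩ := Nat.exists_eq_add_of_le' (one_le_two.trans hr)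
  obtain ⟨s, rfl⟩ := Nat.exists_eq_add_of_le' hs
  have h1 : lamY K (r + 1) (s + 1) ^ 2 = lam K (r + 1) (s + 1) .al * lam K (r + 1) (s + 1) .ab +
      lam K (r + 1) (s + 1) .ab * lam K (r + 1) (s + 1) .al := by
    rw [pow_two, lamY, add_mul, mul_add, mul_add,
      lam_mul_eq_zero lam_al_mul_e2 lam_e1_mul_al lam_e2_mul_e1,
      lam_mul_eq_zero lam_ab_mul_e1 lam_e2_mul_ab lam_e1_mul_e2, zero_add, add_zero]
  rw [pow_mul, h1, add_pow_of_mul_eq_zero, lamX, add_pow_of_mul_eq_zero, lam_ep_pow, lam_eb_pow]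
  · exact lam_mul_eq_zero lam_ep_mul_e1 lam_e2_mul_eb lam_e1_mul_e2
  · exact lam_mul_eq_zero lam_eb_mul_e2 lam_e1_mul_ep lam_e2_mul_e1
  · rw [mul_assoc, ← mul_assoc (lam K _ _ .ab), lam_mul_eq_zero lam_ab_mul_e1 lam_e2_mul_ab
      lam_e1_mul_e2, zero_mul, mul_zero]
  · rw [mul_assoc, ← mul_assoc (lam K _ _ .al), lam_mul_eq_zero lam_al_mul_e2 lam_e1_mul_al
      lam_e2_mul_e1, zero_mul, mul_zero]

lemma lam_e1_mul_lamX : lam K r s .e1 * lamX K r s = lam K r s .ep := by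
  rw [lamX, mul_add, lam_e1_mul_ep, lam_mul_eq_zero lam_e1_mul_e1 lam_e2_mul_eb lam_e1_mul_e2,
    add_zero]

lemma lamX_mul_lam_e1 : lamX K r s * lam K r s .e1 = lam K r s .ep := by
  rw [lamX, add_mul, lam_ep_mul_e1, lam_mul_eq_zero lam_eb_mul_e2 lam_e1_mul_e1 lam_e2_mul_e1,
    add_zero]

lemma lam_e2_mul_lamX : lam K r s .e2 * lamX K r s = lam K r s .eb := by
  rw [lamX, mul_add, lam_e2_mul_eb, lam_mul_eq_zero lam_e2_mul_e2 lam_e1_mul_ep lam_e2_mul_e1,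
    zero_add]

lemma lamX_mul_lam_e2 : lamX K r s * lam K r s .e2 = lam K r s .eb := by
  rw [lamX, add_mul, lam_eb_mul_e2, lam_mul_eq_zero lam_ep_mul_e1 lam_e2_mul_e2 lam_e1_mul_e2,
    zero_add]

lemma lam_e1_mul_lamY : lam K r s .e1 * lamY K r s = lam K r s .al := by
  rw [lamY, mul_add, lam_e1_mul_al, lam_mul_eq_zero lam_e1_mul_e1 lam_e2_mul_ab lam_e1_mul_e2,
    add_zero]

lemma lamY_mul_lam_e1 : lamY K r s * lam K r s .e1 = lam K r s .ab := by
  rw [lamY, add_mul, lam_ab_mul_e1, lam_mul_eq_zero lam_al_mul_e2 lam_e1_mul_e1 lam_e2_mul_e1,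
    zero_add]

lemma lam_e2_mul_lamY : lam K r s .e2 * lamY K r s = lam K r s .ab := by
  rw [lamY, mul_add, lam_e2_mul_ab, lam_mul_eq_zero lam_e2_mul_e2 lam_e1_mul_al lam_e2_mul_e1,
    zero_add]

lemma lamY_mul_lam_e2 : lamY K r s * lam K r s .e2 = lam K r s .al := by
  rw [lamY, add_mul, lam_al_mul_e2, lam_mul_eq_zero lam_ab_mul_e1 lam_e2_mul_e2 lam_e1_mul_e2,
    add_zero]

/-! ### A spanning set -/

variable (K r s) in
/-- The linear span of the paths. -/
noncomputable def pathSpan : Submodule K (LambdaAlg K r s) :=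
  Submodule.span K {v | ∃ g : Gen, (g = .e1 ∨ g = .e2) ∧
    ∃ i : ℕ, v = lam K r s g * lamX K r s ^ i ∨ v = lam K r s g * lamY K r s ^ i}

lemma mul_mem_pathSpan_of {c : LambdaAlg K r s}
    (h : ∀ g : Gen, g = .e1 ∨ g = .e2 → ∀ i : ℕ,
      lam K r s g * lamX K r s ^ i * c ∈ pathSpan K r s ∧
      lam K r s g * lamY K r s ^ i * c ∈ pathSpan K r s)
    {v : LambdaAlg K r s} (hv : v ∈ pathSpan K r s) : v * c ∈ pathSpan K r s := by
  induction hv using Submodule.span_induction with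
  | mem v hv =>
    obtain ⟨g, hg, i, rfl | rfl⟩ := hv
    exacts [(h g hg i).1, (h g hg i).2]
  | zero => rw [zero_mul]; exact zero_mem _
  | add v w _ _ hv hw => rw [add_mul]; exact add_mem hv hw
  | smul a v _ hv => rw [smul_mul_assoc]; exact Submodule.smul_mem _ _ hv

lemma e_mul_X_pow_mem {g : Gen} (hg : g = .e1 ∨ g = .e2) (i : ℕ) :
    lam K r s g * lamX K r s ^ i ∈ pathSpan K r s :=
  Submodule.subset_span ⟨g, hg, i, Or.inl rfl⟩

lemma e_mul_Y_pow_mem {g : Gen} (hg : g = .e1 ∨ g = .e2) (i : ℕ) :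
    lam K r s g * lamY K r s ^ i ∈ pathSpan K r s :=
  Submodule.subset_span ⟨g, hg, i, Or.inr rfl⟩

lemma mul_lamX_mem {v : LambdaAlg K r s} (hv : v ∈ pathSpan K r s) :
    v * lamX K r s ∈ pathSpan K r s := by
  refine mul_mem_pathSpan_of (fun g hg i => ⟨?_, ?_⟩) hv
  · rw [mul_assoc, ← pow_succ]; exact e_mul_X_pow_mem hg _
  · cases i with
    | zero => simpa using e_mul_X_pow_mem hg 1
    | succ i => rw [pow_succ, mul_assoc, mul_assoc, lamY_mul_lamX, mul_zero, mul_zero]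
                exact zero_mem _

lemma mul_lamY_mem {v : LambdaAlg K r s} (hv : v ∈ pathSpan K r s) :
    v * lamY K r s ∈ pathSpan K r s := by
  refine mul_mem_pathSpan_of (fun g hg i => ⟨?_, ?_⟩) hv
  · cases i with
    | zero => simpa using e_mul_Y_pow_mem hg 1
    | succ i => rw [pow_succ, mul_assoc, mul_assoc, lamX_mul_lamY, mul_zero, mul_zero]
                exact zero_mem _
  · rw [mul_assoc, ← pow_succ]; exact e_mul_Y_pow_mem hg _

lemma e_mul_e_mem {g g' : Gen} (hg : g = .e1 ∨ g = .e2) (hg' : g' = .e1 ∨ g' = .e2) :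
    lam K r s g * lam K r s g' ∈ pathSpan K r s := by
  have h1 := e_mul_X_pow_mem (K := K) (r := r) (s := s) hg 0
  rw [pow_zero, mul_one] at h1
  rcases hg with rfl | rfl <;> rcases hg' with rfl | rfl
  · rwa [lam_e1_mul_e1]
  · rw [lam_e1_mul_e2]; exact zero_mem _
  · rw [lam_e2_mul_e1]; exact zero_mem _
  · rwa [lam_e2_mul_e2]

lemma lamX_pow_mul_e {g : Gen} (hg : g = .e1 ∨ g = .e2) (i : ℕ) :
    lamX K r s ^ i * lam K r s g = lam K r s g * lamX K r s ^ i := by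
  refine (Commute.pow_left (?_ : Commute (lamX K r s) (lam K r s g)) i)
  rcases hg with rfl | rfl
  · exact lamX_mul_lam_e1.trans lam_e1_mul_lamX.symm
  · exact lamX_mul_lam_e2.trans lam_e2_mul_lamX.symm

lemma exists_lamY_pow_mul_e {g : Gen} (hg : g = .e1 ∨ g = .e2) (i : ℕ) :
    ∃ g' : Gen, (g' = .e1 ∨ g' = .e2) ∧
      lamY K r s ^ i * lam K r s g = lam K r s g' * lamY K r s ^ i := by
  induction i generalizing g with
  | zero => exact ⟨g, hg, by simp⟩
  | succ i ih =>
    obtain ⟨g₁, hg₁, h₁⟩ : ∃ g' : Gen, (g' = .e1 ∨ g' = .e2) ∧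
        lamY K r s * lam K r s g = lam K r s g' * lamY K r s := by
      rcases hg with rfl | rfl
      · exact ⟨.e2, Or.inr rfl, lamY_mul_lam_e1.trans lam_e2_mul_lamY.symm⟩
      · exact ⟨.e1, Or.inl rfl, lamY_mul_lam_e2.trans lam_e1_mul_lamY.symm⟩
    obtain ⟨g₂, hg₂, h₂⟩ := ih hg₁
    exact ⟨g₂, hg₂, by rw [pow_succ, mul_assoc, h₁, ← mul_assoc, h₂, mul_assoc]⟩

lemma mul_X_pow_mem {v : LambdaAlg K r s} (hv : v ∈ pathSpan K r s) (i : ℕ) :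
    v * lamX K r s ^ i ∈ pathSpan K r s := by
  induction i with
  | zero => simpa using hv
  | succ i ih => rw [pow_succ, ← mul_assoc]; exact mul_lamX_mem ih

lemma mul_Y_pow_mem {v : LambdaAlg K r s} (hv : v ∈ pathSpan K r s) (i : ℕ) :
    v * lamY K r s ^ i ∈ pathSpan K r s := by
  induction i with
  | zero => simpa using hv
  | succ i ih => rw [pow_succ, ← mul_assoc]; exact mul_lamY_mem ih

lemma mul_e_mem {v : LambdaAlg K r s} (hv : v ∈ pathSpan K r s) {g : Gen}
    (hg : g = .e1 ∨ g = .e2) : v * lam K r s g ∈ pathSpan K r s := by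
  refine mul_mem_pathSpan_of (fun g' hg' i => ⟨?_, ?_⟩) hv
  · rw [mul_assoc, lamX_pow_mul_e hg, ← mul_assoc]
    exact mul_X_pow_mem (e_mul_e_mem hg' hg) i
  · obtain ⟨g₁, hg₁, h⟩ := exists_lamY_pow_mul_e (K := K) (r := r) (s := s) hg i
    rw [mul_assoc, h, ← mul_assoc]
    exact mul_Y_pow_mem (e_mul_e_mem hg' hg₁) i

lemma mul_lam_mem {v : LambdaAlg K r s} (hv : v ∈ pathSpan K r s) (g : Gen) :
    v * lam K r s g ∈ pathSpan K r s := by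
  cases g with
  | e1 => exact mul_e_mem hv (Or.inl rfl)
  | e2 => exact mul_e_mem hv (Or.inr rfl)
  | ep => rw [← lam_e1_mul_lamX, ← mul_assoc]; exact mul_lamX_mem (mul_e_mem hv (Or.inl rfl))
  | eb => rw [← lam_e2_mul_lamX, ← mul_assoc]; exact mul_lamX_mem (mul_e_mem hv (Or.inr rfl))
  | al => rw [← lam_e1_mul_lamY, ← mul_assoc]; exact mul_lamY_mem (mul_e_mem hv (Or.inl rfl))
  | ab => rw [← lam_e2_mul_lamY, ← mul_assoc]; exact mul_lamY_mem (mul_e_mem hv (Or.inr rfl))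

lemma mem_pathSpan (v : LambdaAlg K r s) : v ∈ pathSpan K r s := by
  have key : ∀ a : FreeAlgebra K Gen, ∀ v ∈ pathSpan K r s,
      v * RingQuot.mkAlgHom K (RelL K r s) a ∈ pathSpan K r s := by
    intro a
    induction a using FreeAlgebra.induction with
    | grade0 k =>
      intro v hv
      rw [AlgHom.commutes, ← Algebra.commutes, ← Algebra.smul_def]
      exact Submodule.smul_mem _ _ hv
    | grade1 g => exact fun v hv => mul_lam_mem hv g
    | mul a b ha hb => intro v hv; rw [map_mul, ← mul_assoc]; exact hb _ (ha v hv)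
    | add a b ha hb => intro v hv; rw [map_add, mul_add]; exact add_mem (ha v hv) (hb v hv)
  obtain ⟨a, rfl⟩ := RingQuot.mkAlgHom_surjective K (RelL K r s) v
  rw [← one_mul (RingQuot.mkAlgHom K (RelL K r s) a)]
  refine key a _ ?_
  rw [← lam_e1_add_e2]
  exact add_mem (by simpa using e_mul_X_pow_mem (Or.inl rfl) 0)
    (by simpa using e_mul_X_pow_mem (Or.inr rfl) 0)

lemma exists_eq_aeval (v : LambdaAlg K r s) : ∃ P Q P' Q' : K[X],
    v = lam K r s .e1 * (aeval (lamX K r s) P + aeval (lamY K r s) Q) +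
      lam K r s .e2 * (aeval (lamX K r s) P' + aeval (lamY K r s) Q') := by
  induction mem_pathSpan v using Submodule.span_induction with
  | mem v hv =>
    obtain ⟨g, rfl | rfl, i, rfl | rfl⟩ := hv
    · exact ⟨X ^ i, 0, 0, 0, by simp⟩
    · exact ⟨0, X ^ i, 0, 0, by simp⟩
    · exact ⟨0, 0, X ^ i, 0, by simp⟩
    · exact ⟨0, 0, 0, X ^ i, by simp⟩
  | zero => exact ⟨0, 0, 0, 0, by simp⟩
  | add v w _ _ hv hw =>
    obtain ⟨P, Q, P', Q', rfl⟩ := hv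
    obtain ⟨R, S, R', S', rfl⟩ := hw
    refine ⟨P + R, Q + S, P' + R', Q' + S', ?_⟩
    simp only [map_add, mul_add]
    abel
  | smul a v _ hv =>
    obtain ⟨P, Q, P', Q', rfl⟩ := hv
    exact ⟨a • P, a • Q, a • P', a • Q', by simp [mul_add]⟩

end Lambda

section Socle
open Polynomial

variable {K : Type} [Field K] {r s : ℕ}

variable (K) in
/-- The ideal generated by `X Y` and `X ^ r - Y ^ t`. -/
noncomputable def socleIdeal (r t : ℕ) : Ideal K[X][X] :=
  Ideal.span {C X * X, C X ^ r - X ^ t}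

lemma C_X_pow_notMem {r t : ℕ} (hr : 1 ≤ r) (ht : 1 ≤ t) :
    (C X ^ r : K[X][X]) ∉ socleIdeal K r t := by
  have key : ∀ P ∈ socleIdeal K r t, (P.coeff 0).coeff r + (P.coeff t).coeff 0 = 0 := by
    obtain ⟨t, rfl⟩ := Nat.exists_eq_add_of_le' ht
    obtain ⟨r, rfl⟩ := Nat.exists_eq_add_of_le' hr
    intro P hP
    obtain ⟨a, b, rfl⟩ := Ideal.mem_span_pair.1 hP
    have h1 : ((a * (C X * X)).coeff 0).coeff (r + 1) +
        ((a * (C X * X)).coeff (t + 1)).coeff 0 = 0 := by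
      rw [← mul_assoc, coeff_mul_X, coeff_mul_C]
      simp
    have h2 : ((b * (C X ^ (r + 1) - X ^ (t + 1))).coeff 0).coeff (r + 1) +
        ((b * (C X ^ (r + 1) - X ^ (t + 1))).coeff (t + 1)).coeff 0 = 0 := by
      simp only [mul_sub, ← C_pow, coeff_sub, coeff_mul_C, coeff_mul_X_pow']
      simp
    rw [coeff_add, coeff_add, coeff_add, coeff_add]
    linear_combination h1 + h2
  intro h
  have := key _ h
  rw [← C_pow, coeff_C_zero, coeff_C_of_ne_zero (by omega)] at this
  simp at this

lemma corner_pow {B : Type} [CommRing B] (a : B) (n : ℕ) :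
    (!![a, 0; 0, 0] : Matrix (Fin 2) (Fin 2) B) ^ (n + 1) = !![a ^ (n + 1), 0; 0, 0] := by
  induction n with
  | zero => simp
  | succ n ih =>
    rw [pow_succ, ih, Matrix.mul_fin_two]
    simp only [pow_succ, mul_zero, add_zero, zero_mul]

lemma corner_pow' {B : Type} [CommRing B] (a : B) (n : ℕ) :
    (!![0, 0; 0, a] : Matrix (Fin 2) (Fin 2) B) ^ (n + 1) = !![0, 0; 0, a ^ (n + 1)] := by
  induction n with
  | zero => simp
  | succ n ih =>
    rw [pow_succ, ih, Matrix.mul_fin_two]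
    simp only [pow_succ, mul_zero, zero_add, zero_mul]

/-- A matrix representation of `Λ`. -/
noncomputable def lamRep {B : Type} [CommRing B] [Algebra K B] (x y : B) (hr : 1 ≤ r) (hs : 1 ≤ s)
    (hxy : x * y = 0) (hpow : x ^ r = y ^ (2 * s)) :
    LambdaAlg K r s →ₐ[K] Matrix (Fin 2) (Fin 2) B :=
  RingQuot.liftAlgHom K ⟨FreeAlgebra.lift K fun g => match g with
      | Gen.e1 => !![1, 0; 0, 0]
      | Gen.e2 => !![0, 0; 0, 1]
      | Gen.ep => !![x, 0; 0, 0]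
      | Gen.eb => !![0, 0; 0, x]
      | Gen.al => !![0, y; 0, 0]
      | Gen.ab => !![0, 0; y, 0],
    by
      obtain ⟨r, rfl⟩ := Nat.exists_eq_add_of_le' hr
      obtain ⟨s, rfl⟩ := Nat.exists_eq_add_of_le' hs
      have hyx : y * x = 0 := by rw [mul_comm, hxy]
      have h0 : (0 : Matrix (Fin 2) (Fin 2) B) = !![0, 0; 0, 0] := by
        ext i j; fin_cases i <;> fin_cases j <;> rfl
      have hadd : (!![1, 0; 0, 0] : Matrix (Fin 2) (Fin 2) B) + !![0, 0; 0, 1] = 1 := by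
        ext i j; fin_cases i <;> fin_cases j <;> simp
      rw [pow_mul, pow_two] at hpow
      intro a b h
      cases h <;>
        simp only [map_add, map_mul, map_pow, map_zero, map_one, FreeAlgebra.lift_ι_apply, hadd,
          Matrix.mul_fin_two, mul_zero, zero_mul, mul_one, one_mul, add_zero, zero_add,
          corner_pow, corner_pow', hxy, hyx, hpow, h0]⟩

lemma lam_e_mul_lamX_pow_ne_zero_of_rep {B : Type} [CommRing B] [Algebra K B] {x y : B}
    (hr : 1 ≤ r) (hs : 1 ≤ s) (hxy : x * y = 0) (hpow : x ^ r = y ^ (2 * s)) (hx : x ^ r ≠ 0) :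
    lam K r s .e1 * lamX K r s ^ r ≠ 0 ∧ lam K r s .e2 * lamX K r s ^ r ≠ 0 := by
  have h1 : lamRep x y hr hs hxy hpow (lam K r s .e1) = !![1, 0; 0, 0] := by simp [lamRep, lam]
  have h2 : lamRep x y hr hs hxy hpow (lam K r s .e2) = !![0, 0; 0, 1] := by simp [lamRep, lam]
  have h3 : lamRep x y hr hs hxy hpow (lamX K r s) = Matrix.diagonal fun _ => x := by
    have e1 : lamRep x y hr hs hxy hpow (lam K r s .ep) = !![x, 0; 0, 0] := by simp [lamRep, lam]
    have e2 : lamRep x y hr hs hxy hpow (lam K r s .eb) = !![0, 0; 0, x] := by simp [lamRep, lam]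
    rw [lamX, map_add, e1, e2]
    ext i j
    fin_cases i <;> fin_cases j <;> simp
  constructor
  · intro h
    have h4 := congrArg (lamRep x y hr hs hxy hpow) h
    rw [map_mul, map_pow, h1, h3, Matrix.diagonal_pow, map_zero] at h4
    exact hx (by simpa [Matrix.mul_diagonal] using congrFun (congrFun h4 0) 0)
  · intro h
    have h4 := congrArg (lamRep x y hr hs hxy hpow) h
    rw [map_mul, map_pow, h2, h3, Matrix.diagonal_pow, map_zero] at h4
    exact hx (by simpa [Matrix.mul_diagonal] using congrFun (congrFun h4 1) 1)

lemma lam_e_mul_lamX_pow_ne_zero (hr : 2 ≤ r) (hs : 1 ≤ s) :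
    lam K r s .e1 * lamX K r s ^ r ≠ 0 ∧ lam K r s .e2 * lamX K r s ^ r ≠ 0 := by
  refine lam_e_mul_lamX_pow_ne_zero_of_rep
    (x := Ideal.Quotient.mk (socleIdeal K r (2 * s)) (C X))
    (y := Ideal.Quotient.mk (socleIdeal K r (2 * s)) X) (one_le_two.trans hr) hs ?_ ?_ ?_
  · rw [← map_mul]
    exact Ideal.Quotient.eq_zero_iff_mem.2 (Ideal.subset_span (by simp))
  · rw [← map_pow, ← map_pow]
    exact Ideal.Quotient.eq.2 (Ideal.subset_span (by simp))
  · rw [← map_pow]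
    exact fun h => C_X_pow_notMem (by omega) (by omega) (Ideal.Quotient.eq_zero_iff_mem.1 h)

lemma isBiserial_lambda (hr : 2 ≤ r) (hs : 1 ≤ s) :
    IsBiserial K (lam K r s .e1) (lam K r s .e2) (lamX K r s) (lamY K r s) r (2 * s) where
  two_le_left := hr
  two_le_right := by omega
  mul_eq_zero := lamX_mul_lamY
  mul_eq_zero' := lamY_mul_lamX
  pow_eq := lamX_pow hr hs
  e_mul_e := lam_e1_mul_e1
  e_mul_f := lam_e1_mul_e2
  f_mul_e := lam_e2_mul_e1
  f_mul_f := lam_e2_mul_e2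
  e_mul_pow := (lam_e_mul_lamX_pow_ne_zero hr hs).1
  f_mul_pow := (lam_e_mul_lamX_pow_ne_zero hr hs).2
  exists_eq := exists_eq_aeval

end Socle

section Simple
open MulOpposite CategoryTheory
variable {K : Type} [Field K] {r s : ℕ}

/-- The underlying scalar of an element of `SimpleBimod`. -/
noncomputable def toScalar (f g : LambdaAlg K r s →ₐ[K] K) : SimpleBimod K r s f g ≃+ K :=
  AddEquiv.refl _

lemma toScalar_tmul_smul (f g : LambdaAlg K r s →ₐ[K] K) (a b : LambdaAlg K r s)
    (k : SimpleBimod K r s f g) :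
    toScalar f g ((op a ⊗ₜ[K] b) • k) = f a * g b * toScalar f g k := by
  change phiBim K r s f g (op a ⊗ₜ[K] b) * toScalar f g k = _
  rw [phiBim, Algebra.TensorProduct.lift_tmul]
  rfl

variable {M : Type} [AddCommGroup M] [Module K M] [Module (LambdaAlg K r s) M]
  [IsScalarTower K (LambdaAlg K r s) M]

lemma nonempty_simpleBimod_iso (f g : LambdaAlg K r s →ₐ[K] K) {ψ : Module.Dual K M}
    (hψ : ψ ∈ chiHom f M) {m : M} (hm : ψ m = 1) (hspan : ∀ v : M, ∃ k : K, v = k • m) :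
    Nonempty (SimpleBimod K r s f g ≅ dualBimod g M) := by
  let F : SimpleBimod K r s f g →+ dualBimod g M :=
    AddMonoidHom.mk' (fun k => (toDual g M).symm (toScalar f g k • ψ))
      (fun a b => by rw [map_add, add_smul, map_add])
  let φ : SimpleBimod K r s f g ⟶ dualBimod g M := homMk F fun a b k => by
    apply (toDual g M).injective
    ext v
    rw [toDual_tmul_smul]
    change toScalar f g ((op a ⊗ₜ[K] b) • k) * ψ v = g b * (toScalar f g k * ψ (a • v))
    rw [toScalar_tmul_smul, hψ]
    ring
  have hinj : Function.Injective φ := fun k l h => by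
    apply (toScalar f g).injective
    have h1 : toScalar f g k * ψ m = toScalar f g l * ψ m :=
      congrArg (fun c => toDual g M c m) h
    rwa [hm, mul_one, mul_one] at h1
  have hsurj : Function.Surjective φ := fun c => by
    refine ⟨(toScalar f g).symm (toDual g M c m), ?_⟩
    apply (toDual g M).injective
    ext v
    change toDual g M c m * ψ v = toDual g M c v
    obtain ⟨k, rfl⟩ := hspan v
    rw [map_smul, map_smul, hm, smul_eq_mul, smul_eq_mul, mul_one, mul_comm]
  have : IsIso φ := (ConcreteCategory.isIso_iff_bijective φ).2 ⟨hinj, hsurj⟩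
  exact ⟨asIso φ⟩

end Simple

namespace Zigzag
section Augmentation
variable {K : Type} [Field K] {A : Type} [Ring A] [Algebra K A] (Z : Zigzag A)

lemma d_zero_apply (v : Z.term 1) :
    (Z.d 0 v : ℕ → A) 0 = (v : ℕ → A) 0 * Z.x + (v : ℕ → A) 1 * Z.y := by
  rw [coe_d, Z.dSeq_apply_of_le _ le_rfl]
  simp [z, a, b]

/-- The functional on the cokernel of `d 0` induced by a character. -/
noncomputable def augmentation (f : A →ₐ[K] K) (hx : f Z.x = 0) (hy : f Z.y = 0) :
    Module.Dual K (Z.term 0 ⧸ LinearMap.range (Z.d 0)) :=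
  ((LinearMap.range (Z.d 0)).restrictScalars K).liftQ
    (f.toLinearMap.comp (((LinearMap.proj 0).comp (Z.term 0).subtype).restrictScalars K)) (by
      rintro _ ⟨v, rfl⟩
      change f ((Z.d 0 v : ℕ → A) 0) = 0
      rw [d_zero_apply, map_add, map_mul, map_mul, hx, hy, mul_zero, mul_zero, add_zero])

lemma augmentation_mem (f : A →ₐ[K] K) (hx : f Z.x = 0) (hy : f Z.y = 0) :
    Z.augmentation f hx hy ∈ chiHom f (Z.term 0 ⧸ LinearMap.range (Z.d 0)) := fun a v => by
  obtain ⟨v, rfl⟩ := Submodule.mkQ_surjective _ v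
  change f (a * (v : ℕ → A) 0) = f a * f ((v : ℕ → A) 0)
  rw [map_mul]

lemma augmentation_gen (f : A →ₐ[K] K) (hx : f Z.x = 0) (hy : f Z.y = 0) :
    Z.augmentation f hx hy ((LinearMap.range (Z.d 0)).mkQ (Z.gen 0 0)) = f (Z.idem 0) := by
  change f ((Z.gen 0 0 : ℕ → A) 0) = _
  simp [gen]

lemma exists_eq_smul_gen
    (h : ∀ a : A, ∃ (k : K) (w u : A), a * Z.idem 0 = k • Z.idem 0 + (w * Z.x + u * Z.y))
    (v : Z.term 0 ⧸ LinearMap.range (Z.d 0)) :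
    ∃ k : K, v = k • (LinearMap.range (Z.d 0)).mkQ (Z.gen 0 0) := by
  obtain ⟨v, rfl⟩ := Submodule.mkQ_surjective _ v
  obtain ⟨k, w, u, h⟩ := h (v.1 0)
  refine ⟨k, (Submodule.Quotient.eq _).2 ?_⟩
  refine ⟨⟨Pi.single 0 (w * Z.idem 0) + Pi.single 1 (u * Z.idem 1), fun j => ?_⟩, ?_⟩
  · rcases j with _ | _ | j
    · simp [mul_assoc, Z.idem_mul_self]
    · simp [mul_assoc, Z.idem_mul_self]
    · simp
  · refine Subtype.ext (funext fun j => ?_)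
    rcases j with _ | j
    · rw [d_zero_apply]
      have h1 := congrArg (· * Z.idem 0) h
      have h2 := (v.2 0).1
      simp only [add_mul, mul_assoc, smul_mul_assoc, Z.idem_mul_self, ← Z.idem_mul_x] at h1
      have h3 : Z.y * Z.idem 0 = Z.idem 1 * Z.y := by
        rw [Z.idem_mul_y, Z.idem_add_two]
      rw [h3, show v.1 0 * Z.idem 0 = v.1 0 from h2] at h1
      have h4 : (k • Z.gen 0 0 : Z.term 0).1 0 = k • Z.idem 0 := by
        change k • (Z.gen 0 0).1 0 = _
        simp [gen]
      change _ = v.1 0 - (k • Z.gen 0 0 : Z.term 0).1 0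
      rw [h4, h1]
      simp [mul_assoc]
    · rw [(Z.d 0 _).2 _ |>.2 (by omega), ((v - k • Z.gen 0 0 : Z.term 0).2 _).2 (by omega)]

end Augmentation
end Zigzag

lemma IsBiserial.exists_mul_eq {K : Type} [Field K] {A : Type} [Ring A] [Algebra K A]
    {e f x y : A} {p q : ℕ} (h : IsBiserial K e f x y p q) (hex : e * x = x * e)
    (hfy : f * y = y * e) (a : A) :
    ∃ (k : K) (w u : A), a * e = k • e + (w * x + u * y) := by
  obtain ⟨P, P', u, rfl⟩ := h.exists_eq' a
  have h1 : ∀ P : Polynomial K, Polynomial.aeval x P =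
      Polynomial.aeval x P.divX * x + algebraMap K A (P.coeff 0) := fun P => by
    conv_lhs => rw [← Polynomial.divX_mul_X_add P]
    simp
  refine ⟨P.coeff 0, e * Polynomial.aeval x P.divX * e + f * Polynomial.aeval x P'.divX * e,
    u * f, ?_⟩
  rw [h1 P, h1 P']
  simp only [mul_add, add_mul, mul_assoc, ← hex, hfy, h.e_mul_e, h.f_mul_e,
    Algebra.algebraMap_eq_smul_one, smul_mul_assoc, mul_smul_comm, mul_one, smul_zero]
  abel

section Count

lemma card_filter_even (n : ℕ) (p : ℕ → Prop) [DecidablePred p] (m : ℕ)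
    (hp : ∀ j, p j ↔ Even (m + j)) :
    ((Finset.range n).filter p).card = (n + (m + 1) % 2) / 2 := by
  induction n with
  | zero => simp
  | succ n ih =>
    rw [Finset.range_add_one, Finset.filter_insert]
    split_ifs with h
    · rw [Finset.card_insert_of_notMem (by simp), ih]
      rw [hp, Nat.even_iff] at h
      omega
    · rw [ih]
      rw [hp, Nat.even_iff] at h
      omega

end Count

section Main
open CategoryTheory
variable {K : Type} [Field K] {r s : ℕ}

/-- The zigzag data of `Λ` whose sequence of idempotents starts at the first vertex. -/
noncomputable def zigzagOne (hr : 2 ≤ r) (hs : 1 ≤ s) : Zigzag (LambdaAlg K r s) where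
  x := lamX K r s
  y := lamY K r s
  p := r
  q := 2 * s
  idem k := if Even k then lam K r s .e1 else lam K r s .e2
  exactPair := (isBiserial_lambda hr hs).exactPair
  even_q := even_two_mul s
  idem_mul_self k := by split_ifs; exacts [lam_e1_mul_e1, lam_e2_mul_e2]
  idem_add_two k := by simp [Nat.even_add]
  idem_mul_x k := by
    split_ifs
    exacts [lam_e1_mul_lamX.trans lamX_mul_lam_e1.symm, lam_e2_mul_lamX.trans lamX_mul_lam_e2.symm]
  idem_mul_y k := by
    by_cases h : Even k
    · simpa [h, Nat.even_add_one] using lam_e1_mul_lamY.trans lamY_mul_lam_e2.symm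
    · simpa [h, Nat.even_add_one] using lam_e2_mul_lamY.trans lamY_mul_lam_e1.symm

/-- The zigzag data of `Λ` whose sequence of idempotents starts at the second vertex. -/
noncomputable def zigzagTwo (hr : 2 ≤ r) (hs : 1 ≤ s) : Zigzag (LambdaAlg K r s) where
  __ := zigzagOne hr hs
  idem k := (zigzagOne hr hs).idem (k + 1)
  idem_mul_self _ := (zigzagOne hr hs).idem_mul_self _
  idem_add_two _ := (zigzagOne hr hs).idem_add_two _
  idem_mul_x _ := (zigzagOne hr hs).idem_mul_x _
  idem_mul_y _ := (zigzagOne hr hs).idem_mul_y _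

lemma IsBiserial.swap {A : Type} [Ring A] [Algebra K A] {e f x y : A} {p q : ℕ}
    (h : IsBiserial K e f x y p q) : IsBiserial K f e x y p q where
  two_le_left := h.two_le_left
  two_le_right := h.two_le_right
  mul_eq_zero := h.mul_eq_zero
  mul_eq_zero' := h.mul_eq_zero'
  pow_eq := h.pow_eq
  e_mul_e := h.f_mul_f
  e_mul_f := h.f_mul_e
  f_mul_e := h.e_mul_f
  f_mul_f := h.e_mul_e
  e_mul_pow := h.f_mul_pow
  f_mul_pow := h.e_mul_pow
  exists_eq v := by
    obtain ⟨P, Q, P', Q', hv⟩ := h.exists_eq v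
    exact ⟨P', Q', P, Q, by rw [hv, add_comm]⟩

lemma Zigzag.finrank_ext_simpleBimod (Z : Zigzag (LambdaAlg K r s))
    (h : ∀ a, ∃ (k : K) (w u : LambdaAlg K r s),
      a * Z.idem 0 = k • Z.idem 0 + (w * Z.x + u * Z.y))
    (f g : LambdaAlg K r s →ₐ[K] K) (hfx : f Z.x = 0) (hfy : f Z.y = 0) (hf : f (Z.idem 0) = 1)
    (hgx : g Z.x = 0) (hgy : g Z.y = 0) (n : ℕ) :
    Module.finrank K (((Ext K (ModuleCat (LambdaAe K r s)) n).obj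
      (Opposite.op (LambdaBimod K r s))).obj (SimpleBimod K r s f g)) = (Z.support g n).card := by
  obtain ⟨i⟩ := nonempty_simpleBimod_iso f g (Z.augmentation_mem f hfx hfy)
    ((Z.augmentation_gen f hfx hfy).trans hf) (Z.exists_eq_smul_gen h)
  exact (((Ext K (ModuleCat (LambdaAe K r s)) n).obj (Opposite.op (LambdaBimod K r s))).mapIso
    i).toLinearEquiv.finrank_eq.trans (Z.finrank_ext g hgx hgy n)

lemma Zigzag.card_support {A : Type} [Ring A] [Algebra K A] (Z : Zigzag A) (χ : A →ₐ[K] K)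
    (n c : ℕ) (h : ∀ k, χ (Z.idem k) = 1 ↔ Even (c + k)) :
    (Z.support χ n).card = (n + 1 + (c + n / 2 + 1) % 2) / 2 := by
  classical
  rw [Zigzag.support, ← card_filter_even (n + 1) (fun j => χ (Z.idem (n / 2 + j)) = 1) (c + n / 2)
    (fun j => by rw [h, add_assoc])]

variable (hr : 2 ≤ r) (hs : 1 ≤ s)

lemma chi1_lamX : chi1 K r s hr hs (lamX K r s) = 0 := by simp [chi1, lamX, lam]
lemma chi1_lamY : chi1 K r s hr hs (lamY K r s) = 0 := by simp [chi1, lamY, lam]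
lemma chi2_lamX : chi2 K r s hr hs (lamX K r s) = 0 := by simp [chi2, lamX, lam]
lemma chi2_lamY : chi2 K r s hr hs (lamY K r s) = 0 := by simp [chi2, lamY, lam]
lemma chi1_e1 : chi1 K r s hr hs (lam K r s .e1) = 1 := by simp [chi1, lam]
lemma chi1_e2 : chi1 K r s hr hs (lam K r s .e2) = 0 := by simp [chi1, lam]
lemma chi2_e1 : chi2 K r s hr hs (lam K r s .e1) = 0 := by simp [chi2, lam]
lemma chi2_e2 : chi2 K r s hr hs (lam K r s .e2) = 1 := by simp [chi2, lam]

lemma chi1_idem (k : ℕ) :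
    chi1 K r s hr hs ((zigzagOne hr hs).idem k) = 1 ↔ Even k := by
  by_cases h : Even k <;> simp [zigzagOne, h, chi1_e1, chi1_e2]

lemma chi2_idem (k : ℕ) :
    chi2 K r s hr hs ((zigzagOne hr hs).idem k) = 1 ↔ Even (1 + k) := by
  by_cases h : Even k <;> simp [zigzagOne, h, chi2_e1, chi2_e2, add_comm 1 k, Nat.even_add_one]

lemma zigzagOne_exists_mul_eq (a : LambdaAlg K r s) : ∃ (k : K) (w u : LambdaAlg K r s),
    a * (zigzagOne hr hs).idem 0 =
      k • (zigzagOne hr hs).idem 0 + (w * (zigzagOne hr hs).x + u * (zigzagOne hr hs).y) := by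
  simpa [zigzagOne] using (isBiserial_lambda hr hs).exists_mul_eq
    (lam_e1_mul_lamX.trans lamX_mul_lam_e1.symm) (lam_e2_mul_lamY.trans lamY_mul_lam_e1.symm) a

lemma zigzagTwo_exists_mul_eq (a : LambdaAlg K r s) : ∃ (k : K) (w u : LambdaAlg K r s),
    a * (zigzagTwo hr hs).idem 0 =
      k • (zigzagTwo hr hs).idem 0 + (w * (zigzagTwo hr hs).x + u * (zigzagTwo hr hs).y) := by
  simpa [zigzagTwo, zigzagOne] using (isBiserial_lambda hr hs).swap.exists_mul_eq
    (lam_e2_mul_lamX.trans lamX_mul_lam_e2.symm) (lam_e1_mul_lamY.trans lamY_mul_lam_e2.symm) a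

end Main
end EnvExt

open CategoryTheory in
/-- Dimensions of `Ext^n_{Λ^e}(Λ, T_{ij})`, for `n = 4k+i` with `0 ≤ i ≤ 3`: these are the
multiplicities of the projective bimodules `Λe_i ⊗ e_jΛ` in the minimal projective
bimodule resolution of `Λ`. -/
theorem dim_ext_Lambda_simple_bimodules (K : Type) [Field K] [IsAlgClosed K]
    (r s : ℕ) (hr : 2 ≤ r) (hs : 1 ≤ s)
    (n k i : ℕ) (hi : i ≤ 3) (hnki : n = 4 * k + i) :
    Module.finrank K
        (((Ext K (ModuleCat (LambdaAe K r s)) n).obj (Opposite.op (LambdaBimod K r s))).obj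
          (SimpleBimod K r s (chi1 K r s hr hs) (chi1 K r s hr hs))) =
      (if i ≤ 1 then 2 * k + 1 else 2 * k + i - 1) ∧
    Module.finrank K
        (((Ext K (ModuleCat (LambdaAe K r s)) n).obj (Opposite.op (LambdaBimod K r s))).obj
          (SimpleBimod K r s (chi2 K r s hr hs) (chi2 K r s hr hs))) =
      (if i ≤ 1 then 2 * k + 1 else 2 * k + i - 1) ∧
    Module.finrank K
        (((Ext K (ModuleCat (LambdaAe K r s)) n).obj (Opposite.op (LambdaBimod K r s))).obj
          (SimpleBimod K r s (chi1 K r s hr hs) (chi2 K r s hr hs))) =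
      (if i ≤ 1 then 2 * k + i else 2 * k + 2) ∧
    Module.finrank K
        (((Ext K (ModuleCat (LambdaAe K r s)) n).obj (Opposite.op (LambdaBimod K r s))).obj
          (SimpleBimod K r s (chi2 K r s hr hs) (chi1 K r s hr hs))) =
      (if i ≤ 1 then 2 * k + i else 2 * k + 2) := by
  have h1 := EnvExt.chi1_idem (K := K) hr hs
  have h2 := EnvExt.chi2_idem (K := K) hr hs
  have x1 := EnvExt.chi1_lamX (K := K) hr hs
  have y1 := EnvExt.chi1_lamY (K := K) hr hs
  have x2 := EnvExt.chi2_lamX (K := K) hr hs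
  have y2 := EnvExt.chi2_lamY (K := K) hr hs
  have f1 := (h1 0).2 (by simp)
  have f2 := (h2 1).2 (by decide)
  have m1 := EnvExt.zigzagOne_exists_mul_eq (K := K) hr hs
  have m2 := EnvExt.zigzagTwo_exists_mul_eq (K := K) hr hs
  refine ⟨?_, ?_, ?_, ?_⟩
  · rw [EnvExt.Zigzag.finrank_ext_simpleBimod _ m1 _ _ x1 y1 f1 x1 y1,
      EnvExt.Zigzag.card_support _ _ n 0 fun k => (h1 k).trans (by rw [zero_add])]
    split_ifs <;> omega
  · rw [EnvExt.Zigzag.finrank_ext_simpleBimod _ m2 _ _ x2 y2 f2 x2 y2,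
      EnvExt.Zigzag.card_support _ _ n 0 fun k => (h2 (k + 1)).trans (by grind)]
    split_ifs <;> omega
  · rw [EnvExt.Zigzag.finrank_ext_simpleBimod _ m1 _ _ x1 y1 f1 x2 y2,
      EnvExt.Zigzag.card_support _ _ n 1 h2]
    split_ifs <;> omega
  · rw [EnvExt.Zigzag.finrank_ext_simpleBimod _ m2 _ _ x2 y2 f2 x1 y1,
      EnvExt.Zigzag.card_support _ _ n 1 fun k => (h1 (k + 1)).trans (by rw [add_comm])]
    split_ifs <;> omega
end
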